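/- Let P and Q be two vertex-disjoint 2-paths of a graph G. If D is a drawing of G in the plane whose restriction to P ∪ Q is a clam, then D is not pseudolinear. -/

import Mathlib

open Set

noncomputable section

abbrev Plane : Type := ℝ × ℝ

/-- The setoid on nonzero vectors of `ℝ³` identifying nonzero scalar multiples. -/
def projSetoid : Setoid {v : Fin 3 → ℝ // v ≠ 0} where
  r v w := ∃ c : ℝ, c ≠ 0 ∧ c • v.1 = w.1
  iseqv := by
    constructor
    · exact fun v => ⟨1, one_ne_zero, one_smul _ _⟩
    · rintro v w ⟨c, hc, h⟩
      exact ⟨c⁻¹, inv_ne_zero hc, by rw [← h, smul_smul, inv_mul_cancel₀ hc, one_smul]⟩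
    · rintro u v w ⟨c, hc, h⟩ ⟨d, hd, h'⟩
      exact ⟨d * c, mul_ne_zero hd hc, by rw [← h', ← h, smul_smul]⟩

/-- The real projective plane, as the quotient of `ℝ³ \ {0}` by nonzero scaling. -/
def RP2 : Type := Quotient projSetoid

instance : TopologicalSpace RP2 := instTopologicalSpaceQuotient

/-- The standard affine embedding of the plane in the projective plane. -/
def planeToRP2 (p : Plane) : RP2 :=
  Quotient.mk projSetoid ⟨![p.1, p.2, 1], by
    intro h
    simpa using congrFun h 2⟩

/-- A pseudoline: a simple closed curve in the projective plane that does not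
disconnect it. -/
def IsPseudoline (L : Set RP2) : Prop :=
  ∃ f : AddCircle (1 : ℝ) → RP2,
    Continuous f ∧ Function.Injective f ∧ Set.range f = L ∧ IsConnected Lᶜ

/-- A drawing of a graph in the plane: vertices are distinct points, each edge is a
simple arc (parametrized on `[0,1]`) joining its endpoints, and no arc passes
through a vertex other than its endpoints. -/
structure Drawing {V : Type*} (G : SimpleGraph V) where
  vert : V → Plane
  vert_inj : Function.Injective vert
  arc : G.edgeSet → ℝ → Plane
  arc_cont : ∀ e, ContinuousOn (arc e) (Icc 0 1)
  arc_injOn : ∀ e, InjOn (arc e) (Icc 0 1)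
  arc_ends : ∀ e : G.edgeSet, ∃ x y : V,
    (e : Sym2 V) = s(x, y) ∧ arc e 0 = vert x ∧ arc e 1 = vert y
  arc_avoid : ∀ (e : G.edgeSet) (t : ℝ), t ∈ Icc (0:ℝ) 1 →
    (∃ v, arc e t = vert v) → t = 0 ∨ t = 1

namespace Drawing

variable {V : Type*} {G : SimpleGraph V} (D : Drawing G)

/-- The interior (relative to its endpoints) of the arc of an edge. -/
def interOf (e : G.edgeSet) : Set Plane := D.arc e '' Ioo 0 1

/-- The set of crossings of a drawing: pairs consisting of a point of the plane
together with an (unordered) pair of distinct edges whose interiors both pass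
through the point. -/
def CrossSet : Set (Plane × Sym2 G.edgeSet) :=
  { x | ∃ e f : G.edgeSet, e ≠ f ∧ x.2 = s(e, f) ∧
      x.1 ∈ D.interOf e ∧ x.1 ∈ D.interOf f }

/-- The weighted number of crossings of a drawing: each crossing of a pair of
edges `e`, `f` contributes `w e * w f`. -/
def wcount (w : Sym2 V → ℕ) : ℕ :=
  ∑ᶠ x ∈ D.CrossSet,
    Sym2.lift ⟨fun e f : G.edgeSet => w e * w f, fun e f => mul_comm _ _⟩ x.2

/-- A drawing is pseudolinear if each edge can be extended to a pseudoline of the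
projective plane (via the standard affine embedding of the plane in the projective
plane) so that the extensions form a pseudoline arrangement: any two of the
pseudolines extending distinct edges meet in exactly one point. -/
def IsPseudolinear : Prop :=
  ∃ L : G.edgeSet → Set RP2,
    (∀ e, IsPseudoline (L e)) ∧
    (∀ e, ∀ t ∈ Icc (0:ℝ) 1, planeToRP2 (D.arc e t) ∈ L e) ∧
    (∀ e f, e ≠ f → ∃! p, p ∈ L e ∧ p ∈ L f)

/-- A drawing is rectilinear if every edge is drawn as a straight line segment. -/
def IsRectilinear : Prop :=
  ∀ e, ∀ t ∈ Icc (0:ℝ) 1, D.arc e t = (1 - t) • D.arc e 0 + t • D.arc e 1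

/-- A drawing is x-monotone if every edge meets every vertical line in at most one
point. -/
def IsMonotone : Prop :=
  ∀ e, InjOn (fun t => (D.arc e t).1) (Icc 0 1)

end Drawing

/-- The crossing number of `G` relative to a class of drawings `P`: the minimum
number of crossings in a drawing of `G` satisfying `P` (with finitely many
crossings). -/
def crNumP {V : Type*} (G : SimpleGraph V) (P : Drawing G → Prop) : ℕ :=
  sInf { n | ∃ D : Drawing G, P D ∧ D.CrossSet.Finite ∧ D.CrossSet.ncard = n }

/-- The crossing number `cr G`. -/
def crNum {V : Type*} (G : SimpleGraph V) : ℕ := crNumP G fun _ => True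

/-- The pseudolinear crossing number `pcr G`. -/
def pcrNum {V : Type*} (G : SimpleGraph V) : ℕ := crNumP G Drawing.IsPseudolinear

/-- The rectilinear crossing number `rcr G`. -/
def rcrNum {V : Type*} (G : SimpleGraph V) : ℕ := crNumP G Drawing.IsRectilinear

/-- The monotone crossing number `mon-cr G`. -/
def moncrNum {V : Type*} (G : SimpleGraph V) : ℕ := crNumP G Drawing.IsMonotone

/-- The weighted crossing number of `(G, w)` relative to a class of drawings. -/
def wcrNumP {V : Type*} (G : SimpleGraph V) (w : Sym2 V → ℕ) (P : Drawing G → Prop) : ℕ :=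
  sInf { n | ∃ D : Drawing G, P D ∧ D.CrossSet.Finite ∧ D.wcount w = n }

/-- The weighted crossing number `cr (G, w)`. -/
def wcrNum {V : Type*} (G : SimpleGraph V) (w : Sym2 V → ℕ) : ℕ :=
  wcrNumP G w fun _ => True

/-- The weighted pseudolinear crossing number `pcr (G, w)`. -/
def wpcrNum {V : Type*} (G : SimpleGraph V) (w : Sym2 V → ℕ) : ℕ :=
  wcrNumP G w Drawing.IsPseudolinear

/-- The weighted rectilinear crossing number `rcr (G, w)`. -/
def wrcrNum {V : Type*} (G : SimpleGraph V) (w : Sym2 V → ℕ) : ℕ :=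
  wcrNumP G w Drawing.IsRectilinear

/-- A nowhere vanishing continuous function on a simply connected space has a continuous
logarithm. -/
theorem exists_continuous_log {X : Type*} [TopologicalSpace X] [SimplyConnectedSpace X]
    [LocallyPathConnectedSpace X] {f : X → ℂ} (hf : Continuous f) (h0 : ∀ x, f x ≠ 0) :
    ∃ g : X → ℂ, Continuous g ∧ ∀ x, Complex.exp (g x) = f x := by
  obtain ⟨x₀⟩ : Nonempty X := inferInstance
  obtain ⟨F, ⟨-, hF⟩, -⟩ := Complex.isCoveringMapOn_exp.existsUnique_continuousMap_lifts
    ⟨f, hf⟩ (a₀ := x₀) (Complex.exp_log (h0 x₀)) h0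
  exact ⟨F, F.continuous, fun x => congrFun hF x⟩

open Classical in
/-- The variation over `[0, 1]` of a continuous logarithm of `h`. -/
def logVar (h : ℝ → ℂ) : ℂ :=
  if H : ∃ g : ℝ → ℂ, Continuous g ∧ ∀ t, Complex.exp (g t) = h t then
    H.choose 1 - H.choose 0 else 0

theorem logVar_eq {h g : ℝ → ℂ} (hg : Continuous g) (hgh : ∀ t, Complex.exp (g t) = h t) :
    logVar h = g 1 - g 0 := by
  have H : ∃ g : ℝ → ℂ, Continuous g ∧ ∀ t, Complex.exp (g t) = h t := ⟨g, hg, hgh⟩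
  rw [logVar, dif_pos H]
  obtain ⟨hc, he⟩ := H.choose_spec
  set k := H.choose
  have key : ∀ t, ∃ n : ℤ, g t - k t = n * (2 * Real.pi * Complex.I) := by
    intro t
    obtain ⟨n, hn⟩ := Complex.exp_eq_exp_iff_exists_int.1 ((hgh t).trans (he t).symm)
    exact ⟨n, by rw [hn]; ring⟩
  choose n hn using key
  have hnc : Continuous fun t => ((n t : ℤ) : ℝ) := by
    have : (fun t => ((n t : ℤ) : ℝ)) = fun t => ((g t - k t) / (2 * Real.pi * Complex.I)).re := by
      ext t
      rw [hn, mul_div_cancel_right₀ _ Complex.two_pi_I_ne_zero]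
      simp
    rw [this]
    fun_prop
  have hnc' : Continuous n := Int.isClosedEmbedding_coe_real.isInducing.continuous_iff.2 hnc
  have h01 : n 0 = n 1 := by
    have := (isPreconnected_univ (α := ℝ)).constant hnc'.continuousOn (mem_univ 0) (mem_univ 1)
    exact this
  have e0 := hn 0
  have e1 := hn 1
  rw [h01] at e0
  linear_combination e0 - e1

theorem exp_logVar {h : ℝ → ℂ} (hc : Continuous h) (h0 : ∀ t, h t ≠ 0) :
    Complex.exp (logVar h) = h 1 / h 0 := by
  obtain ⟨g, hg, hgh⟩ := exists_continuous_log hc h0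
  rw [logVar_eq hg hgh, Complex.exp_sub, hgh, hgh]

theorem logVar_neg {h : ℝ → ℂ} (hc : Continuous h) (h0 : ∀ t, h t ≠ 0) :
    logVar (fun t => -h t) = logVar h := by
  obtain ⟨g, hg, hgh⟩ := exists_continuous_log hc h0
  rw [logVar_eq hg hgh, logVar_eq (g := fun t => g t + Real.pi * Complex.I)]
  · ring
  · fun_prop
  · intro t
    rw [Complex.exp_add, hgh, Complex.exp_pi_mul_I]; ring

theorem logVar_square {f : ℝ × ℝ → ℂ} (hf : Continuous f) (h0 : ∀ x, f x ≠ 0) :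
    logVar (fun t => f (0, t)) + logVar (fun s => f (s, 1)) =
      logVar (fun s => f (s, 0)) + logVar (fun t => f (1, t)) := by
  obtain ⟨g, hg, hgf⟩ := exists_continuous_log hf h0
  rw [logVar_eq (g := fun t => g (0, t)) (by fun_prop) fun t => hgf _,
    logVar_eq (g := fun s => g (s, 1)) (by fun_prop) fun t => hgf _,
    logVar_eq (g := fun s => g (s, 0)) (by fun_prop) fun t => hgf _,
    logVar_eq (g := fun t => g (1, t)) (by fun_prop) fun t => hgf _]
  ring

theorem Path.extend_mem_of_forall {X : Type*} [TopologicalSpace X] {x y : X} (γ : Path x y)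
    {F : Set X} (h : ∀ t, γ t ∈ F) (t : ℝ) : γ.extend t ∈ F := by
  have : γ.extend t ∈ range γ.extend := mem_range_self t
  rw [Path.extend_range] at this
  obtain ⟨s, hs⟩ := this
  exact hs ▸ h s

/-- The complete bipartite graph on three plus three vertices is not planar. -/
theorem not_planar_three_three (x y : Fin 3 → ℂ) (E : Fin 3 → Fin 3 → Set ℂ)
    (hE : ∀ i j, JoinedIn (E i j) (x i) (y j))
    (hd : ∀ i j k l, i ≠ k → j ≠ l → Disjoint (E i j) (E k l)) : False := by
  choose p hp using hE
  set γ : Fin 3 → Fin 3 → ℝ → ℂ := fun i j => (p i j).extend with hγ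
  have hγc : ∀ i j, Continuous (γ i j) := fun i j => (p i j).continuous_extend
  have e0 : ∀ i j, γ i j 0 = x i := fun i j => (p i j).extend_zero
  have e1 : ∀ i j, γ i j 1 = y j := fun i j => (p i j).extend_one
  have hne : ∀ i j k l, i ≠ k → j ≠ l → ∀ s t, γ k l t - γ i j s ≠ 0 := by
    intro i j k l h1 h2 s t h
    refine Set.disjoint_left.1 (hd i j k l h1 h2) ((p i j).extend_mem_of_forall (hp i j) s) ?_
    have := (p k l).extend_mem_of_forall (hp k l) t
    rwa [show (p k l).extend t = (p i j).extend s from sub_eq_zero.1 h] at this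
  have other : ∀ j : Fin 3, ∃ l, j ≠ l := by decide
  have hx : ∀ i k l, i ≠ k → ∀ t, γ k l t - x i ≠ 0 := by
    intro i k l hik t
    obtain ⟨j, hj⟩ := other l
    rw [← e0 i j]
    exact hne i j k l hik hj.symm 0 t
  have hy : ∀ j k l, j ≠ l → ∀ t, γ k l t - y j ≠ 0 := by
    intro j k l hjl t
    obtain ⟨i, hi⟩ := other k
    rw [← e1 i j]
    exact hne i j k l hi.symm hjl 1 t
  have hxx : ∀ i k, i ≠ k → x k - x i ≠ 0 := fun i k h => e0 k 0 ▸ hx i k 0 h 0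
  have hyy : ∀ j l, j ≠ l → y l - y j ≠ 0 := fun j l h => e1 0 l ▸ hy j 0 l h 1
  have hxy : ∀ i j, y j - x i ≠ 0 := fun i j => by
    obtain ⟨k, hk⟩ := other i
    exact e1 k j ▸ hx i k j hk 1
  set W₁ : Fin 3 → Fin 3 → Fin 3 → ℂ := fun i k l => logVar fun t => γ k l t - x i with hW₁
  set W₂ : Fin 3 → Fin 3 → Fin 3 → ℂ := fun j k l => logVar fun t => γ k l t - y j with hW₂
  have rel : ∀ i j k l, i ≠ k → j ≠ l → W₁ i k l + W₂ l i j = W₁ k i j + W₂ j k l := by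
    intro i j k l hik hjl
    have hc := hγc i j
    have hc' := hγc k l
    have := logVar_square (f := fun z => γ k l z.2 - γ i j z.1) (by fun_prop)
      fun z => hne i j k l hik hjl _ _
    simp only [e0, e1] at this
    rw [← logVar_neg (h := fun s => y l - γ i j s) (by fun_prop) fun t => by
        rw [← neg_sub]; exact neg_ne_zero.2 (hy l i j hjl.symm t),
      ← logVar_neg (h := fun s => x k - γ i j s) (by fun_prop) fun t => by
        rw [← neg_sub]; exact neg_ne_zero.2 (hx k i j hik.symm t)] at this
    simpa only [neg_sub] using this
  set M : Fin 3 → Fin 3 → ℂ := fun i j => Complex.log (y j - x i) with hM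
  have hMexp : ∀ i j, Complex.exp (M i j) = y j - x i := fun i j => Complex.exp_log (hxy i j)
  have chords : ∀ z : Fin 3 → ℂ, (∀ i k, i ≠ k → z k - z i ≠ 0) → ∃ X : Fin 3 → Fin 3 → ℂ,
      (∀ i k, i ≠ k → Complex.exp (X i k) = z k - z i) ∧
      ∀ i k, i < k → X k i = X i k + Real.pi * Complex.I := by
    intro z hz
    refine ⟨fun i k => if i < k then Complex.log (z k - z i) else
      Complex.log (z i - z k) + Real.pi * Complex.I, ?_, ?_⟩
    · intro i k hik
      by_cases h : i < k
      · simp only [h, if_true, Complex.exp_log (hz i k hik)]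
      · simp only [h, if_false, Complex.exp_add, Complex.exp_log (hz k i hik.symm),
          Complex.exp_pi_mul_I]
        ring
    · intro i k h
      simp [h, h.not_gt]
  obtain ⟨X, hXexp, hXs⟩ := chords x hxx
  obtain ⟨Y, hYexp, hYs⟩ := chords y hyy
  have h₁ : ∀ i k l, ∃ n : ℤ, i ≠ k →
      W₁ i k l = M i l - X i k + n * (2 * Real.pi * Complex.I) := by
    intro i k l
    by_cases h : i = k
    · exact ⟨0, fun h' => absurd h h'⟩
    · have hc := hγc k l
      obtain ⟨n, hn⟩ := Complex.exp_eq_exp_iff_exists_int.1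
        (show Complex.exp (W₁ i k l) = Complex.exp (M i l - X i k) by
          rw [hW₁, exp_logVar (by fun_prop) (hx i k l h), e0, e1, Complex.exp_sub, hMexp,
            hXexp i k h])
      exact ⟨n, fun _ => hn⟩
  have h₂ : ∀ j k l, ∃ n : ℤ, j ≠ l →
      W₂ j k l = Y j l - (M k j + Real.pi * Complex.I) + n * (2 * Real.pi * Complex.I) := by
    intro j k l
    by_cases h : j = l
    · exact ⟨0, fun h' => absurd h h'⟩
    · have hc := hγc k l
      obtain ⟨n, hn⟩ := Complex.exp_eq_exp_iff_exists_int.1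
        (show Complex.exp (W₂ j k l) = Complex.exp (Y j l - (M k j + Real.pi * Complex.I)) by
          rw [hW₂, exp_logVar (by fun_prop) (hy j k l h), e0, e1, Complex.exp_sub,
            Complex.exp_add, hMexp, hYexp j l h, Complex.exp_pi_mul_I, mul_neg_one, neg_sub])
      exact ⟨n, fun _ => hn⟩
  choose a ha using h₁
  choose b hb using h₂
  have cast_eq : ∀ m : ℤ, (m : ℂ) * (Real.pi * Complex.I) = 0 → m = 0 := by
    intro m hm
    have : (m : ℂ) = 0 := by
      rcases mul_eq_zero.1 hm with h | h
      · exact h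
      · simp [Real.pi_ne_zero] at h
    exact_mod_cast this
  have quad : ∀ i k j l, i < k → j < l →
      a i k l + b l i j + 1 = a k i j + b j k l ∧ a i k j + b j i l = a k i l + b l k j := by
    intro i k j l hik hjl
    have r1 := rel i j k l hik.ne hjl.ne
    have r2 := rel i l k j hik.ne hjl.ne'
    rw [ha _ _ _ hik.ne, ha _ _ _ hik.ne', hb _ _ _ hjl.ne, hb _ _ _ hjl.ne', hXs _ _ hik,
      hYs _ _ hjl] at r1 r2
    constructor
    · have := cast_eq (2 * (a i k l + b l i j + 1 - (a k i j + b j k l))) (by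
        push_cast; linear_combination r1)
      omega
    · have := cast_eq (2 * (a i k j + b j i l - (a k i l + b l k j))) (by
        push_cast; linear_combination r2)
      omega
  have q := fun i k hik => And.intro (quad i k 0 1 hik (by decide))
    (And.intro (quad i k 0 2 hik (by decide)) (quad i k 1 2 hik (by decide)))
  have q0 := q 0 1 (by decide)
  have q1 := q 0 2 (by decide)
  have q2 := q 1 2 (by decide)
  clear q quad
  omega

theorem ContinuousOn.joinedIn_image_Icc {X : Type*} [TopologicalSpace X] {g : ℝ → X} {s t x y : ℝ}
    (hg : ContinuousOn g (Icc s t)) (hx : x ∈ Icc s t) (hy : y ∈ Icc s t) :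
    JoinedIn (g '' Icc s t) (g x) (g y) :=
  (((convex_Icc s t).isPathConnected ⟨x, hx⟩).joinedIn x hx y hy).map_continuousOn hg

theorem isPathConnected_compl_ball {E : Type*} [NormedAddCommGroup E] [NormedSpace ℝ E]
    (h : 1 < Module.rank ℝ E) {R : ℝ} (hR : 0 < R) : IsPathConnected {z : E | R ≤ ‖z‖} := by
  have : {z : E | R ≤ ‖z‖} = (fun z : E => max 1 (R / ‖z‖) • z) '' {0}ᶜ := by
    ext z
    constructor
    · intro (hz : R ≤ ‖z‖)
      have h0 : 0 < ‖z‖ := hR.trans_le hz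
      refine ⟨z, norm_pos_iff.1 h0, ?_⟩
      simp [max_eq_left ((div_le_one h0).2 hz)]
    · rintro ⟨z, hz, rfl⟩
      have h0 : 0 < ‖z‖ := norm_pos_iff.2 hz
      rw [mem_ofPred_eq, norm_smul, Real.norm_eq_abs, abs_of_pos (by positivity)]
      calc R = R / ‖z‖ * ‖z‖ := by field_simp
        _ ≤ _ := by gcongr; exact le_max_right _ _
  rw [this]
  refine (isPathConnected_compl_singleton_of_one_lt_rank h 0).image' ?_
  refine ContinuousOn.smul (ContinuousOn.sup continuousOn_const
    (continuousOn_const.div continuousOn_id.norm ?_))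
    continuousOn_id
  intro z hz
  exact norm_ne_zero_iff.2 hz

/-- A ray from `a` away from `b`, followed far away by the complement of a large disk. -/
theorem joinedIn_ray_union {E : Type*} [NormedAddCommGroup E] [NormedSpace ℝ E]
    (h : 1 < Module.rank ℝ E) {R : ℝ} (hR : 0 < R) {a b w : E} (hab : a ≠ b) (hw : R ≤ ‖w‖) :
    JoinedIn ((fun t : ℝ => a + t • (a - b)) '' Ici 0 ∪ {z : E | R ≤ ‖z‖}) a w := by
  have hd : 0 < ‖a - b‖ := norm_pos_iff.2 (sub_ne_zero.2 hab)
  set T : ℝ := (R + ‖a‖) / ‖a - b‖ with hT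
  have hT0 : 0 ≤ T := by positivity
  have hTR : R ≤ ‖a + T • (a - b)‖ := by
    have h1 : ‖T • (a - b)‖ = R + ‖a‖ := by
      rw [norm_smul, Real.norm_eq_abs, abs_of_nonneg hT0, hT]
      field_simp
    have h2 := norm_sub_norm_le (T • (a - b)) (-a)
    rw [sub_neg_eq_add, norm_neg, add_comm _ a] at h2
    linarith
  have h1 : JoinedIn ((fun t : ℝ => a + t • (a - b)) '' Icc 0 T) a (a + T • (a - b)) := by
    have := ContinuousOn.joinedIn_image_Icc (g := fun t : ℝ => a + t • (a - b)) (s := 0) (t := T)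
      (x := 0) (y := T) (by fun_prop) ⟨le_rfl, hT0⟩ ⟨hT0, le_rfl⟩
    simpa using this
  exact (h1.mono ((image_mono Icc_subset_Ici_self).trans subset_union_left)).trans
    (((isPathConnected_compl_ball h hR).joinedIn _ hTR _ hw).mono subset_union_right)

theorem AddCircle.coe_injOn_of_abs_sub_lt {S : Set ℝ} (hS : ∀ s ∈ S, ∀ t ∈ S, |s - t| < 1) :
    InjOn (fun t : ℝ => (t : AddCircle (1 : ℝ))) S := by
  intro s hs t ht h
  obtain ⟨n, hn⟩ := (AddCircle.coe_eq_zero_iff (1 : ℝ)).1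
    (show ((s - t : ℝ) : AddCircle (1 : ℝ)) = 0 by
      rw [AddCircle.coe_sub]; exact sub_eq_zero.2 h)
  have := hS s hs t ht
  rw [← hn, zsmul_one] at this
  have hn0 : n = 0 := Int.abs_lt_one_iff.1 (by exact_mod_cast this)
  rw [hn0, zero_zsmul] at hn
  linarith

theorem AddCircle.injOn_const_add_coe {S : Set ℝ} (hS : ∀ s ∈ S, ∀ t ∈ S, |s - t| < 1)
    (c : AddCircle (1 : ℝ)) : InjOn (fun t : ℝ => c + t) S :=
  fun _ hs _ ht h => AddCircle.coe_injOn_of_abs_sub_lt hS hs ht (add_left_cancel h)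

/-- The complement of a simple closed curve in the plane has a bounded path component. -/
theorem exists_bounded_component_compl_range {f : AddCircle (1 : ℝ) → ℂ} (hf : Continuous f)
    (hinj : Function.Injective f) :
    ∃ z₀ ∉ range f, ∃ R : ℝ, ∀ w, JoinedIn (range f)ᶜ z₀ w → ‖w‖ ≤ R := by
  have : Fact ((0 : ℝ) < 1) := ⟨one_pos⟩
  have hJ : IsCompact (range f) := isCompact_range hf
  obtain ⟨⟨a', b'⟩, -, hmax⟩ := (isCompact_univ : IsCompact (univ : Set (AddCircle (1:ℝ) ×
    AddCircle (1:ℝ)))).exists_isMaxOn ⟨(0, 0), trivial⟩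
    (f := fun x => dist (f x.1) (f x.2)) (by fun_prop)
  replace hmax : ∀ x y, dist (f x) (f y) ≤ dist (f a') (f b') := fun x y => hmax (mem_univ (x, y))
  obtain ⟨g, hg⟩ : ∃ g : ℝ → ℂ, g = fun t : ℝ => f (a' + t) := ⟨_, rfl⟩
  have hgc : Continuous g := by
    rw [hg]
    exact hf.comp (continuous_const.add (AddCircle.continuous_mk' 1))
  have hgJ : ∀ t, g t ∈ range f := fun t => hg ▸ mem_range_self _
  have hg1 : InjOn g (Ico 0 1) := hg ▸ hinj.injOn.comp (AddCircle.injOn_const_add_coe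
    (fun s hs t ht => by rw [abs_lt]; constructor <;> linarith [hs.1, hs.2, ht.1, ht.2]) a')
    (mapsTo_univ _ _)
  have hg2 : InjOn g (Ioc 0 1) := hg ▸ hinj.injOn.comp (AddCircle.injOn_const_add_coe
    (fun s hs t ht => by rw [abs_lt]; constructor <;> linarith [hs.1, hs.2, ht.1, ht.2]) a')
    (mapsTo_univ _ _)
  have hg01 : g 1 = g 0 := by simp [hg, AddCircle.coe_period]
  have hsurj : ∀ x, ∃ t ∈ Ico (0 : ℝ) 1, g t = f x := by
    intro x
    have := AddCircle.coe_image_Ico_eq (1 : ℝ) 0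
    obtain ⟨t, ht, htx⟩ := (this ▸ mem_univ (x - a') : x - a' ∈ _ '' Ico (0:ℝ) (0 + 1))
    exact ⟨t, by simpa using ht, by rw [hg]; exact congrArg f (by rw [htx]; abel)⟩
  obtain ⟨τ, hτ, hτb⟩ := hsurj b'
  have ha : g 0 = f a' := by simp [hg]
  rw [← ha, ← hτb] at hmax
  replace hmax : ∀ s t, dist (g s) (g t) ≤ dist (g 0) (g τ) := fun s t => by
    subst hg; exact hmax _ _
  have hab : g 0 ≠ g τ := by
    intro h
    have := hmax 0 (1/2)
    rw [h, dist_self, ← h] at this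
    have := hg1 (by norm_num) (by norm_num) (dist_le_zero.1 this)
    norm_num at this
  have hτ0 : 0 < τ := lt_of_le_of_ne hτ.1 fun h => hab (by rw [← h])
  have hdpos : 0 < dist (g 0) (g τ) := dist_pos.2 hab
  obtain ⟨h, hh⟩ : ∃ h : ℝ → ℝ, h = fun t => dist (g t) (g 0) - dist (g t) (g τ) := ⟨_, rfl⟩
  have hhc : Continuous h := by rw [hh]; fun_prop
  have h0 : h 0 < 0 := by simp [hh, hdpos]
  have h1 : h 1 < 0 := by simp [hh, hg01, hab]
  have hτh : 0 < h τ := by simp [hh, hab.symm]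
  obtain ⟨s₀, hs₀, hs₀'⟩ := intermediate_value_Icc hτ0.le hhc.continuousOn ⟨h0.le, hτh.le⟩
  obtain ⟨t₀, ht₀, ht₀'⟩ := intermediate_value_Icc' hτ.2.le hhc.continuousOn ⟨h1.le, hτh.le⟩
  have hZ : IsCompact ((Icc 0 τ ∩ h ⁻¹' {0}) ×ˢ (Icc τ 1 ∩ h ⁻¹' {0})) :=
    (isCompact_Icc.inter_right (isClosed_singleton.preimage hhc)).prod
      (isCompact_Icc.inter_right (isClosed_singleton.preimage hhc))
  obtain ⟨⟨s, t⟩, ⟨⟨hs, hs'⟩, ⟨ht, ht'⟩⟩, hmin⟩ := hZ.exists_isMinOn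
    ⟨(s₀, t₀), ⟨hs₀, hs₀'⟩, ⟨ht₀, ht₀'⟩⟩ (f := fun x => dist (g x.1) (g x.2)) (by fun_prop)
  simp only [mem_preimage, mem_singleton_iff] at hs ht hs' ht'
  have s0 : 0 < s := lt_of_le_of_ne hs.1 fun e => by rw [← e] at hs'; exact h0.ne hs'
  have sτ : s < τ := lt_of_le_of_ne hs.2 fun e => by rw [e] at hs'; exact hτh.ne' hs'
  have τt : τ < t := lt_of_le_of_ne ht.1 fun e => by rw [← e] at ht'; exact hτh.ne' ht'
  have t1 : t < 1 := lt_of_le_of_ne ht.2 fun e => by rw [e] at ht'; exact h1.ne ht'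
  have hst : g s ≠ g t := fun e => by
    have := hg1 ⟨s0.le, sτ.trans hτ.2⟩ ⟨hτ.1.trans τt.le, t1⟩ e
    linarith
  set d : ℝ := dist (g s) (g t) with hd
  have hd0 : 0 < d := dist_pos.2 hst
  have hclose : ∀ x, dist x (g 0) = dist x (g τ) → x ∈ range f →
      dist x (g s) < d → dist x (g t) < d → False := by
    rintro _ hx ⟨y, rfl⟩ h1 h2
    obtain ⟨r, hr, hry⟩ := hsurj y
    rw [← hry] at hx h1 h2
    have hr0 : h r = 0 := by simp [hh, hx]
    rcases le_total r τ with hrτ | hrτ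
    · have : d ≤ dist (g r) (g t) := hmin (show (r, t) ∈ _ from ⟨⟨⟨hr.1, hrτ⟩, hr0⟩, ⟨ht, ht'⟩⟩)
      linarith
    · have : d ≤ dist (g s) (g r) := hmin (show (s, r) ∈ _ from ⟨⟨hs, hs'⟩, ⟨⟨hrτ, hr.2.le⟩, hr0⟩⟩)
      rw [dist_comm] at this
      linarith
  have hbis : ∀ r ∈ Icc (0:ℝ) 1, dist (AffineMap.lineMap (g s) (g t) r) (g 0) =
      dist (AffineMap.lineMap (g s) (g t) r) (g τ) := by
    intro r hr
    rw [← AffineSubspace.mem_perpBisector_iff_dist_eq]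
    refine AffineMap.lineMap_mem r ?_ ?_ <;> rw [AffineSubspace.mem_perpBisector_iff_dist_eq]
    · simp only [hh] at hs'; linarith
    · simp only [hh] at ht'; linarith
  set m : ℂ := AffineMap.lineMap (g s) (g t) (1 / 2 : ℝ) with hm
  have hsegJ : ∀ r ∈ Ioo (0:ℝ) 1, (AffineMap.lineMap (g s) (g t) r : ℂ) ∉ range f := by
    intro r hr hmem
    refine hclose _ (hbis r ⟨hr.1.le, hr.2.le⟩) hmem ?_ ?_
    · rw [dist_lineMap_left, Real.norm_eq_abs, abs_of_pos hr.1]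
      nlinarith [hr.2]
    · rw [dist_lineMap_right, Real.norm_eq_abs, abs_of_pos (by linarith [hr.2])]
      nlinarith [hr.1]
  by_contra! hcon
  obtain ⟨R, hR⟩ := hJ.isBounded.exists_norm_le
  set R' : ℝ := |R| + 1 with hR'
  have hR'0 : 0 < R' := by positivity
  replace hR : ∀ x, ‖g x‖ < R' := fun x => by
    have := hR _ (hgJ x)
    have := le_abs_self R
    linarith
  obtain ⟨w, hw, hwR⟩ := hcon m (hsegJ _ (by norm_num)) R'
  have rank : 1 < Module.rank ℝ ℂ := by rw [Complex.rank_real_complex]; norm_num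
  have segR : ∀ r ∈ Icc (0:ℝ) 1, ‖(AffineMap.lineMap (g s) (g t) r : ℂ)‖ < R' := by
    intro r hr
    have := (convex_ball (0:ℂ) R').lineMap_mem (x := g s) (y := g t) (by simpa using hR s) (by simpa using hR t) hr
    simpa using this
  have outJ : ∀ u v, dist (g u) (g v) = dist (g 0) (g τ) → ∀ x,
      g x ∈ (fun r : ℝ => g u + r • (g u - g v)) '' Ici 0 ∪ {z : ℂ | R' ≤ ‖z‖} → g x = g u := by
    rintro u v huv x (⟨r, hr, hx⟩ | hx)
    · have e : g x - g v = (1 + r) • (g u - g v) := by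
        rw [← hx]; module
      have := hmax x v
      rw [dist_eq_norm, e, norm_smul, ← dist_eq_norm, huv, Real.norm_eq_abs,
        abs_of_pos (by linarith [mem_Ici.1 hr])] at this
      have : r = 0 := by nlinarith [mem_Ici.1 hr]
      rw [← hx, this]; simp
    · exact absurd (hR x) (not_lt.2 hx)
  have outbis : ∀ u v, g u ≠ g v → ∀ x : ℂ, dist x (g u) = dist x (g v) → ‖x‖ < R' →
      x ∉ (fun r : ℝ => g u + r • (g u - g v)) '' Ici 0 ∪ {z : ℂ | R' ≤ ‖z‖} := by
    rintro u v huv x hx hxR (⟨r, hr, rfl⟩ | h)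
    · have e : g u + r • (g u - g v) - g v = (1 + r) • (g u - g v) := by module
      have e' : g u + r • (g u - g v) - g u = r • (g u - g v) := by module
      have hpos : 0 < ‖g u - g v‖ := norm_pos_iff.2 (sub_ne_zero.2 huv)
      have hr' := mem_Ici.1 hr
      rw [dist_eq_norm, dist_eq_norm, e, e', norm_smul, norm_smul, Real.norm_eq_abs,
        Real.norm_eq_abs, abs_of_nonneg hr', abs_of_pos (by linarith)] at hx
      nlinarith
    · exact absurd hxR (not_lt.2 h)
  have hlc : ∀ S : Set ℝ, ContinuousOn (fun r : ℝ => (AffineMap.lineMap (g s) (g t) r : ℂ)) S :=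
    fun S => AffineMap.lineMap_continuous.continuousOn
  have arcs : ∀ p q u v : ℝ, (0 ≤ p ∧ q ≤ 1 ∧ 0 ≤ u ∧ v ≤ 1) → q < u → (0 < p ∨ v < 1) →
      Disjoint (g '' Icc p q) (g '' Icc u v) := by
    rintro p q u v ⟨hp, hq, hu, hv⟩ hqu hpv
    rw [Set.disjoint_left]
    rintro _ ⟨x, hx, rfl⟩ ⟨y, hy, hxy⟩
    rcases hpv with hpv | hpv
    · have := hg2 ⟨by linarith [hx.1, hx.2, hy.1, hy.2], by linarith [hx.1, hx.2, hy.1, hy.2]⟩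
        ⟨by linarith [hx.1, hx.2, hy.1, hy.2], by linarith [hx.1, hx.2, hy.1, hy.2]⟩ hxy
      linarith [hx.1, hx.2, hy.1, hy.2]
    · have := hg1 ⟨by linarith [hx.1, hx.2, hy.1, hy.2], by linarith [hx.1, hx.2, hy.1, hy.2]⟩
        ⟨by linarith [hx.1, hx.2, hy.1, hy.2], by linarith [hx.1, hx.2, hy.1, hy.2]⟩ hxy
      linarith [hx.1, hx.2, hy.1, hy.2]
  have noteq : ∀ p q u : ℝ, (0 ≤ p ∧ q ≤ 1 ∧ 0 ≤ u ∧ u ≤ 1) → (q < u ∧ (0 < p ∨ u < 1) ∨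
      u < p ∧ (0 < u ∨ q < 1)) → g u ∉ g '' Icc p q := by
    rintro p q u ⟨hp, hq, hu, hu'⟩ hor hmem
    have hmem' : g u ∈ g '' Icc u u := ⟨u, ⟨le_rfl, le_rfl⟩, rfl⟩
    rcases hor with ⟨h1, h2⟩ | ⟨h1, h2⟩
    · exact Set.disjoint_left.1 (arcs p q u u ⟨hp, hq, hu, hu'⟩ h1 h2) hmem hmem'
    · exact Set.disjoint_left.1 (arcs u u p q ⟨hu, hu', hp, hq⟩ h1 h2) hmem' hmem
  have hτ1 := hτ.2
  set Oa : Set ℂ := (fun r : ℝ => g 0 + r • (g 0 - g τ)) '' Ici 0 ∪ {z : ℂ | R' ≤ ‖z‖} with hOa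
  set Ob : Set ℂ := (fun r : ℝ => g τ + r • (g τ - g 0)) '' Ici 0 ∪ {z : ℂ | R' ≤ ‖z‖} with hOb
  have dOa : ∀ p q : ℝ, g 0 ∉ g '' Icc p q → Disjoint (g '' Icc p q) Oa := by
    intro p q hpq
    rw [Set.disjoint_left]
    rintro _ ⟨x, hx, rfl⟩ hxO
    exact hpq ⟨x, hx, outJ 0 τ rfl x hxO⟩
  have dOb : ∀ p q : ℝ, g τ ∉ g '' Icc p q → Disjoint (g '' Icc p q) Ob := by
    intro p q hpq
    rw [Set.disjoint_left]
    rintro _ ⟨x, hx, rfl⟩ hxO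
    exact hpq ⟨x, hx, outJ τ 0 (dist_comm _ _) x hxO⟩
  have lOa : ∀ p q : ℝ, 0 ≤ p → q ≤ 1 →
      Disjoint Oa (AffineMap.lineMap (g s) (g t) '' Icc p q) := by
    intro p q hp hq
    rw [Set.disjoint_right]
    rintro _ ⟨r, hr, rfl⟩
    exact outbis 0 τ hab _ (hbis r ⟨hp.trans hr.1, hr.2.trans hq⟩)
      (segR r ⟨hp.trans hr.1, hr.2.trans hq⟩)
  have lOb : ∀ p q : ℝ, 0 ≤ p → q ≤ 1 →
      Disjoint Ob (AffineMap.lineMap (g s) (g t) '' Icc p q) := by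
    intro p q hp hq
    rw [Set.disjoint_right]
    rintro _ ⟨r, hr, rfl⟩
    exact outbis τ 0 hab.symm _ (hbis r ⟨hp.trans hr.1, hr.2.trans hq⟩).symm
      (segR r ⟨hp.trans hr.1, hr.2.trans hq⟩)
  have dJ : ∀ p q : ℝ, Disjoint (g '' Icc p q) (range f)ᶜ := fun p q =>
    disjoint_compl_right.mono_left (by rintro _ ⟨x, -, rfl⟩; exact hgJ x)
  have dl : ∀ p q : ℝ, g s ∉ g '' Icc p q →
      Disjoint (g '' Icc p q) (AffineMap.lineMap (g s) (g t) '' Icc (0 : ℝ) (1 / 2)) := by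
    intro p q hpq
    rw [Set.disjoint_left]
    rintro _ ⟨x, hx, rfl⟩ ⟨r, hr, hrx⟩
    rcases hr.1.eq_or_lt with h | h
    · apply hpq
      rw [← h, AffineMap.lineMap_apply_zero] at hrx
      exact ⟨x, hx, hrx.symm⟩
    · exact hsegJ r ⟨h, by linarith [hr.2]⟩ (hrx ▸ hgJ x)
  have dr : ∀ p q : ℝ, g t ∉ g '' Icc p q →
      Disjoint (g '' Icc p q) (AffineMap.lineMap (g s) (g t) '' Icc (1 / 2 : ℝ) 1) := by
    intro p q hpq
    rw [Set.disjoint_left]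
    rintro _ ⟨x, hx, rfl⟩ ⟨r, hr, hrx⟩
    rcases hr.2.eq_or_lt with h | h
    · apply hpq
      rw [h, AffineMap.lineMap_apply_one] at hrx
      exact ⟨x, hx, hrx.symm⟩
    · exact hsegJ r ⟨by linarith [hr.1], h⟩ (hrx ▸ hgJ x)
  have j₁ : JoinedIn (g '' Icc t 1) (g 0) (g t) := by
    rw [← hg01]
    exact hgc.continuousOn.joinedIn_image_Icc ⟨t1.le, le_rfl⟩ ⟨le_rfl, t1.le⟩
  have j₂ : JoinedIn (AffineMap.lineMap (g s) (g t) '' Icc (0 : ℝ) (1 / 2)) m (g s) := by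
    have := (hlc (Icc 0 (1 / 2))).joinedIn_image_Icc (x := 1 / 2) (y := 0) (by norm_num) (by norm_num)
    rwa [AffineMap.lineMap_apply_zero] at this
  have j₃ : JoinedIn (AffineMap.lineMap (g s) (g t) '' Icc (1 / 2 : ℝ) 1) m (g t) := by
    have := (hlc (Icc (1 / 2) 1)).joinedIn_image_Icc (x := 1 / 2) (y := 1) (by norm_num) (by norm_num)
    rwa [AffineMap.lineMap_apply_one] at this
  have e₁ : JoinedIn (g '' Icc 0 s) (g 0) (g s) :=
    hgc.continuousOn.joinedIn_image_Icc ⟨le_rfl, s0.le⟩ ⟨s0.le, le_rfl⟩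
  have e₂ : JoinedIn (g '' Icc s τ) (g τ) (g s) :=
    hgc.continuousOn.joinedIn_image_Icc ⟨sτ.le, le_rfl⟩ ⟨le_rfl, sτ.le⟩
  have e₃ : JoinedIn (g '' Icc τ t) (g τ) (g t) :=
    hgc.continuousOn.joinedIn_image_Icc ⟨le_rfl, τt.le⟩ ⟨τt.le, le_rfl⟩
  have oa : JoinedIn Oa (g 0) w := joinedIn_ray_union rank hR'0 hab hwR.le
  have ob : JoinedIn Ob (g τ) w := joinedIn_ray_union rank hR'0 hab.symm hwR.le
  have n₁ : g τ ∉ g '' Icc 0 s := noteq _ _ _ (by grind) (by grind)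
  have n₂ : g t ∉ g '' Icc 0 s := noteq _ _ _ (by grind) (by grind)
  have n₃ : g t ∉ g '' Icc s τ := noteq _ _ _ (by grind) (by grind)
  have n₄ : g 0 ∉ g '' Icc s τ := noteq _ _ _ (by grind) (by grind)
  have n₅ : g 0 ∉ g '' Icc τ t := noteq _ _ _ (by grind) (by grind)
  have n₆ : g s ∉ g '' Icc τ t := noteq _ _ _ (by grind) (by grind)
  have n₇ : g s ∉ g '' Icc t 1 := noteq _ _ _ (by grind) (by grind)
  have n₈ : g τ ∉ g '' Icc t 1 := noteq _ _ _ (by grind) (by grind)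
  have a₁ : Disjoint (g '' Icc 0 s) (g '' Icc τ t) := arcs _ _ _ _ (by grind) (by grind) (by grind)
  have a₂ : Disjoint (g '' Icc s τ) (g '' Icc t 1) := arcs _ _ _ _ (by grind) (by grind) (by grind)
  have o₁ := lOa 0 (1 / 2) (by norm_num) (by norm_num)
  have o₂ := lOa (1 / 2) 1 (by norm_num) (by norm_num)
  have o₃ := lOb 0 (1 / 2) (by norm_num) (by norm_num)
  have o₄ := lOb (1 / 2) 1 (by norm_num) (by norm_num)
  obtain ⟨E, hE⟩ : ∃ E : Fin 3 → Fin 3 → Set ℂ, E =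
      ![![g '' Icc 0 s, g '' Icc t 1, Oa], ![g '' Icc s τ, g '' Icc τ t, Ob],
        ![AffineMap.lineMap (g s) (g t) '' Icc (0 : ℝ) (1 / 2),
          AffineMap.lineMap (g s) (g t) '' Icc (1 / 2 : ℝ) 1, (range f)ᶜ]] := ⟨_, rfl⟩
  have key : ∀ i j k l : Fin 3, i < k → j ≠ l → Disjoint (E i j) (E k l) := by
    subst hE
    intro i j k l hik hjl
    fin_cases i <;> fin_cases k <;> (try exact absurd hik (by decide)) <;>
    fin_cases j <;> fin_cases l <;> (try exact absurd rfl hjl)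
    exacts [a₁, dOb _ _ n₁, a₂.symm, dOb _ _ n₈, (dOa _ _ n₄).symm, (dOa _ _ n₅).symm,
      dr _ _ n₂, dJ _ _, dl _ _ n₇, dJ _ _, o₁, o₂,
      dr _ _ n₃, dJ _ _, dl _ _ n₆, dJ _ _, o₃, o₄]
  refine not_planar_three_three ![g 0, g τ, m] ![g s, g t, w] E ?_ fun i j k l hik hjl => ?_
  · subst hE
    intro i j
    fin_cases i <;> fin_cases j <;> assumption
  · rcases lt_or_gt_of_ne hik with h | h
    · exact key i j k l h hjl
    · exact (key k l i j h hjl.symm).symm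

instance : T2Space RP2 := by
  have hpos : ∀ v : {v : Fin 3 → ℝ // v ≠ 0}, 0 < ∑ k, v.1 k ^ 2 := by
    intro v
    obtain ⟨i, hi⟩ := Function.ne_iff.1 v.2
    exact Finset.sum_pos' (fun _ _ => sq_nonneg _) ⟨i, Finset.mem_univ i, sq_pos_of_ne_zero hi⟩
  let φ : {v : Fin 3 → ℝ // v ≠ 0} → Fin 3 → Fin 3 → ℝ :=
    fun v i j => v.1 i * v.1 j / ∑ k, v.1 k ^ 2
  have hφ : Continuous φ := by
    have hc : ∀ i, Continuous fun v : {v : Fin 3 → ℝ // v ≠ 0} => v.1 i := fun i =>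
      (continuous_apply i).comp continuous_subtype_val
    exact continuous_pi fun i => continuous_pi fun j => ((hc i).mul (hc j)).div
      (continuous_finsetSum _ fun k _ => (hc k).pow 2) fun v => (hpos v).ne'
  have hlift : ∀ v w : {v : Fin 3 → ℝ // v ≠ 0}, projSetoid v w → φ v = φ w := by
    rintro v w ⟨c, hc, h⟩
    ext i j
    have e : ∀ i, w.1 i = c * v.1 i := fun i => by rw [← h]; simp
    have h0 := (hpos v).ne'
    simp only [φ, e, mul_pow, ← Finset.mul_sum]
    field_simp
  refine T2Space.of_injective_continuous (f := Quotient.lift φ hlift) ?_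
    (hφ.quotient_lift hlift)
  intro x y
  induction x using Quotient.inductionOn with | _ v
  induction y using Quotient.inductionOn with | _ w
  intro (h : φ v = φ w)
  obtain ⟨i, hi⟩ := Function.ne_iff.1 w.2
  have hi : w.1 i ≠ 0 := hi
  have hv := hpos v
  have hw := hpos w
  have e : ∀ j, v.1 i * v.1 j * ∑ k, w.1 k ^ 2 = w.1 i * w.1 j * ∑ k, v.1 k ^ 2 := fun j => by
    have := congrFun (congrFun h i) j
    simp only [φ] at this
    rwa [div_eq_div_iff hv.ne' hw.ne'] at this
  have hvi : v.1 i ≠ 0 := by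
    intro h0
    have := e i
    rw [h0] at this
    simp [hi, hv.ne'] at this
  refine Quotient.sound ⟨w.1 i / v.1 i, div_ne_zero hi hvi, ?_⟩
  ext j
  have h1 := e i
  have h2 := e j
  simp only [Pi.smul_apply, smul_eq_mul]
  rw [div_mul_eq_mul_div, div_eq_iff hvi]
  apply mul_left_cancel₀ (mul_ne_zero hi hv.ne')
  apply mul_left_cancel₀ hvi
  linear_combination v.1 i ^ 2 * h2 - v.1 i * v.1 j * h1

theorem planeToRP2_eq_mk_iff (p : Plane) (v : {v : Fin 3 → ℝ // v ≠ 0}) :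
    planeToRP2 p = Quotient.mk projSetoid v ↔ v.1 2 ≠ 0 ∧ (v.1 0 / v.1 2, v.1 1 / v.1 2) = p := by
  constructor
  · intro h
    obtain ⟨c, hc, h⟩ := Quotient.exact h
    have e0 := congrFun h 0
    have e1 := congrFun h 1
    have e2 := congrFun h 2
    simp at e0 e1 e2
    rw [← e0, ← e1, ← e2]
    refine ⟨hc, Prod.ext ?_ ?_⟩ <;> simp <;> field_simp
  · rintro ⟨h, rfl⟩
    refine Quotient.sound ⟨v.1 2, h, ?_⟩
    ext i
    fin_cases i <;> simp <;> field_simp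

theorem isOpenEmbedding_planeToRP2 : Topology.IsOpenEmbedding planeToRP2 := by
  refine Topology.IsOpenEmbedding.of_continuous_injective_isOpenMap ?_ ?_ ?_
  · refine continuous_quot_mk.comp (Continuous.subtype_mk ?_ _)
    refine continuous_pi fun i => ?_
    fin_cases i <;> simp <;> fun_prop
  · intro p q h
    simpa using ((planeToRP2_eq_mk_iff _ _).1 h).2.symm
  · intro C hC
    have : IsOpen ((Quotient.mk projSetoid) ⁻¹' (planeToRP2 '' C)) := by
      have : (Quotient.mk projSetoid) ⁻¹' (planeToRP2 '' C) =
          {v : {v : Fin 3 → ℝ // v ≠ 0} | v.1 2 ≠ 0} ∩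
            (fun v => (v.1 0 / v.1 2, v.1 1 / v.1 2)) ⁻¹' C := by
        ext v
        constructor
        · rintro ⟨p, hp, h⟩
          obtain ⟨h1, h2⟩ := (planeToRP2_eq_mk_iff _ _).1 h
          exact ⟨h1, by rwa [mem_preimage, h2]⟩
        · rintro ⟨h1, h2⟩
          exact ⟨_, h2, (planeToRP2_eq_mk_iff _ _).2 ⟨h1, rfl⟩⟩
      rw [this]
      refine ContinuousOn.isOpen_inter_preimage ?_ ?_ hC
      · have : ∀ i : Fin 3, ContinuousOn (fun v : {v : Fin 3 → ℝ // v ≠ 0} => v.1 i) {v | v.1 2 ≠ 0} :=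
          fun i => ((continuous_apply i).comp continuous_subtype_val).continuousOn
        exact ((this 0).div (this 2) fun v hv => hv).prodMk ((this 1).div (this 2) fun v hv => hv)
      · exact isOpen_ne_fun ((continuous_apply 2).comp continuous_subtype_val) continuous_const
    exact isQuotientMap_quot_mk.isOpen_preimage.1 this

theorem exists_notMem_range_planeToRP2 : ∃ x, x ∉ range planeToRP2 := by
  refine ⟨Quotient.mk projSetoid ⟨![1, 0, 0], fun h => by simpa using congrFun h 0⟩, ?_⟩
  rintro ⟨p, hp⟩
  simpa using ((planeToRP2_eq_mk_iff _ _).1 hp).1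

theorem IsPseudoline.not_subset_range {L : Set RP2} (hL : IsPseudoline L) :
    ¬ L ⊆ range planeToRP2 := by
  intro hsub
  obtain ⟨g, hg, hinj, rfl, hconn⟩ := hL
  set κ : ℂ → RP2 := planeToRP2 ∘ Complex.equivRealProdCLM with hκ
  have hκo : Topology.IsOpenEmbedding κ := isOpenEmbedding_planeToRP2.comp
    Complex.equivRealProdCLM.toHomeomorph.isOpenEmbedding
  have hκr : range κ = range planeToRP2 :=
    Complex.equivRealProdCLM.surjective.range_comp _
  have hex : ∀ x, ∃ z, κ z = g x := fun x => by
    have := hsub (mem_range_self x)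
    rwa [← hκr] at this
  choose f hf using hex
  have hκf : κ ∘ f = g := funext hf
  have hfc : Continuous f := by
    rw [hκo.isInducing.continuous_iff, hκf]
    exact hg
  have hfi : Function.Injective f := by
    refine Function.Injective.of_comp (f := κ) ?_
    rwa [hκf]
  have hrange : ∀ z, κ z ∈ range g ↔ z ∈ range f := by
    intro z
    constructor
    · rintro ⟨x, hx⟩
      exact ⟨x, hκo.injective (by rw [hf, hx])⟩
    · rintro ⟨x, rfl⟩
      exact ⟨x, (hf x).symm⟩
  obtain ⟨z₀, hz₀, R, hR⟩ := exists_bounded_component_compl_range hfc hfi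
  have hJ : IsOpen (range f)ᶜ := (isCompact_range hfc).isClosed.isOpen_compl
  set C := pathComponentIn (range f)ᶜ z₀ with hC
  have hCo : IsOpen C := hJ.pathComponentIn z₀
  have hCc : IsCompact (closure C) :=
    (Metric.isBounded_closedBall (x := (0 : ℂ)) (r := R)).subset
      (fun w hw => by simpa using hR w hw) |>.isCompact_closure
  have hcl : ∀ y ∈ closure C, y ∉ range f → y ∈ C := by
    intro y hy hyJ
    have hyD : y ∈ pathComponentIn (range f)ᶜ y := mem_pathComponentIn_self hyJ
    obtain ⟨x, hxD, hxC⟩ := mem_closure_iff.1 hy _ (hJ.pathComponentIn y) hyD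
    exact JoinedIn.trans hxC (JoinedIn.symm hxD)
  obtain ⟨q, hq⟩ := exists_notMem_range_planeToRP2
  obtain ⟨x, hx, hx1, hx2⟩ := hconn.isPreconnected (κ '' C) (κ '' closure C)ᶜ
    (hκo.isOpenMap _ hCo) (hCc.image hκo.continuous).isClosed.isOpen_compl
    (by
      intro x hx
      by_cases h : x ∈ κ '' closure C
      · obtain ⟨y, hy, rfl⟩ := h
        exact Or.inl ⟨y, hcl y hy fun h => hx ((hrange y).2 h), rfl⟩
      · exact Or.inr h)
    ⟨κ z₀, fun h => hz₀ ((hrange _).1 h), z₀, mem_pathComponentIn_self hz₀, rfl⟩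
    ⟨q, fun h => hq (hsub h), fun h => hq (hκr ▸ image_subset_range _ _ h)⟩
  exact hx2 (image_mono subset_closure hx1)

theorem exists_exit_point_of_param {a : ℝ → Plane} (hac : ContinuousOn a (Icc 0 1))
    (hai : InjOn a (Icc 0 1)) {G : ℝ → RP2} (hG : Continuous G) (hG1 : InjOn G (Ico 0 1))
    (hG0 : G 0 = planeToRP2 (a 0)) (hG01 : G 1 = G 0)
    (hGr : ¬ ∀ s ∈ Icc (0 : ℝ) 1, G s ∈ range planeToRP2) {θ : ℝ → ℝ}
    (hθ : ContinuousOn θ (Ioc 0 1)) (hθm : ∀ t ∈ Ioc (0 : ℝ) 1, θ t ∈ Ioo (0 : ℝ) 1)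
    (hGθ : ∀ t ∈ Ioc (0 : ℝ) 1, G (θ t) = planeToRP2 (a t))
    (hθ1 : ∀ t ∈ Ioo (0 : ℝ) 1, θ t < θ 1)
    {U : Set Plane} (hUc : IsCompact Uᶜ)
    (haU : ∀ t ∈ Icc (0 : ℝ) 1, a t ∉ U) (h1 : a 1 ∉ closure U) :
    ∃ E ∈ closure U, E ∉ U ∧ E ∉ a '' Icc 0 1 ∧ planeToRP2 E ∈ range G ∧
      ∀ t ∈ Ioc (0 : ℝ) 1, ∃ K : Set Plane, IsClosed K ∧
        (∀ z ∈ K, planeToRP2 z ∈ planeToRP2 '' (a '' Icc 0 1) ∪ range G) ∧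
        Disjoint K U ∧ a 0 ∉ K ∧ JoinedIn K (a t) E := by
  have hι := isOpenEmbedding_planeToRP2
  have one : (1 : ℝ) ∈ Ioc (0 : ℝ) 1 := ⟨one_pos, le_rfl⟩
  have zero' : (0 : ℝ) ∈ Ico (0 : ℝ) 1 := ⟨le_rfl, one_pos⟩
  have hle : ∀ t ∈ Ioc (0 : ℝ) 1, θ t ≤ θ 1 := by
    rintro t ⟨h0, ht⟩
    rcases ht.eq_or_lt with rfl | h
    · exact le_rfl
    · exact (hθ1 t ⟨h0, h⟩).le
  have hcover : ∀ s ∈ Ioc 0 (θ 1), ∃ t ∈ Ioc (0 : ℝ) 1, θ t = s := by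
    intro s hs
    by_contra! hne
    have hgt : ∀ t ∈ Ioc (0 : ℝ) 1, s < θ t := by
      intro t ht
      by_contra! hlt
      obtain ⟨r, hr, hrs⟩ := intermediate_value_Icc ht.2
        (hθ.mono fun r hr => ⟨ht.1.trans_le hr.1, hr.2⟩) ⟨hlt, hs.2⟩
      exact hne r ⟨ht.1.trans_le hr.1, hr.2⟩ hrs
    have hcl : IsClosed (G '' Icc s (θ 1)) := (isCompact_Icc.image hG).isClosed
    have hmem : planeToRP2 (a 0) ∈ G '' Icc s (θ 1) := by
      have hc : ContinuousWithinAt (planeToRP2 ∘ a) (Ioc 0 1) 0 :=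
        ((hι.continuous.comp_continuousOn hac) 0 ⟨le_rfl, zero_le_one⟩).mono Ioc_subset_Icc_self
      have h0 : (0 : ℝ) ∈ closure (Ioc (0 : ℝ) 1) := by
        rw [closure_Ioc zero_ne_one]; exact ⟨le_rfl, zero_le_one⟩
      have := hc.mem_closure h0 (t := G '' Icc s (θ 1)) fun t ht =>
        ⟨θ t, ⟨(hgt t ht).le, hle t ht⟩, hGθ t ht⟩
      rwa [hcl.closure_eq] at this
    obtain ⟨u, hu, hu'⟩ := hmem
    rw [← hG0] at hu'
    have := hG1 ⟨hs.1.le.trans hu.1, hu.2.trans_lt (hθm 1 one).2⟩ zero' hu'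
    linarith [hs.1, hu.1]
  push Not at hGr
  obtain ⟨s₀, hs₀, hs₀r⟩ := hGr
  have hs₀1 : θ 1 < s₀ := by
    by_contra! h
    rcases hs₀.1.eq_or_lt with h0 | h0
    · exact hs₀r ⟨a 0, by rw [← h0, hG0]⟩
    · obtain ⟨t, ht, rfl⟩ := hcover s₀ ⟨h0, h⟩
      exact hs₀r ⟨a t, (hGθ t ht).symm⟩
  have hs₀2 : s₀ < 1 := lt_of_le_of_ne hs₀.2 fun h => hs₀r ⟨a 0, by rw [h, hG01, hG0]⟩
  have hZ : IsClosed (G ⁻¹' (planeToRP2 '' (closure U)ᶜ)ᶜ) :=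
    ((hι.isOpenMap _ isClosed_closure.isOpen_compl).isClosed_compl).preimage hG
  obtain ⟨s, ⟨⟨hs, hsZ⟩, hmin⟩⟩ := (isCompact_Icc.inter_right hZ).exists_isLeast
    (s := Icc (θ 1) 1 ∩ G ⁻¹' (planeToRP2 '' (closure U)ᶜ)ᶜ)
    ⟨s₀, ⟨hs₀1.le, hs₀2.le⟩, fun ⟨z, _, hz⟩ => hs₀r ⟨z, hz⟩⟩
  have hs1 : s < 1 := (hmin ⟨⟨hs₀1.le, hs₀2.le⟩, fun ⟨z, _, hz⟩ => hs₀r ⟨z, hz⟩⟩).trans_lt hs₀2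
  have hθs : θ 1 < s := lt_of_le_of_ne hs.1 fun h => hsZ ⟨a 1, h1, by rw [← h, hGθ 1 one]⟩
  have hbefore : ∀ r ∈ Ico (θ 1) s, ∃ z ∉ closure U, planeToRP2 z = G r := by
    intro r hr
    by_contra h
    have := hmin ⟨⟨hr.1, (hr.2.trans hs1).le⟩, fun ⟨z, hz, hzr⟩ => h ⟨z, hz, hzr⟩⟩
    linarith [hr.2]
  obtain ⟨E, hEU, hE⟩ : G s ∈ planeToRP2 '' Uᶜ := by
    have hcl : IsClosed (planeToRP2 '' Uᶜ) := (hUc.image hι.continuous).isClosed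
    have hsm : s ∈ closure (Ico (θ 1) s) := by
      rw [closure_Ico hθs.ne]; exact ⟨hθs.le, le_rfl⟩
    have := (hG.continuousWithinAt (s := Ico (θ 1) s)).mem_closure hsm (t := planeToRP2 '' Uᶜ)
      fun r hr => by
        obtain ⟨z, hz, hzr⟩ := hbefore r hr
        exact ⟨z, fun h => hz (subset_closure h), hzr⟩
    rwa [hcl.closure_eq] at this
  have hEcl : E ∈ closure U := by
    by_contra h
    exact hsZ ⟨E, h, hE⟩
  have hpos : 0 < θ 1 := (hθm 1 one).1
  refine ⟨E, hEcl, hEU, ?_, ⟨s, hE.symm⟩, ?_⟩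
  · rintro ⟨t, ht, htE⟩
    rcases ht.1.eq_or_lt with h0 | h0
    · rw [← htE, ← h0, ← hG0] at hE
      have := hG1 zero' ⟨hpos.le.trans hθs.le, hs1⟩ hE
      linarith
    · rw [← htE, ← hGθ t ⟨h0, ht.2⟩] at hE
      have hm := hθm t ⟨h0, ht.2⟩
      have := hG1 ⟨hm.1.le, hm.2⟩ ⟨hpos.le.trans hθs.le, hs1⟩ hE
      linarith [hle t ⟨h0, ht.2⟩]
  · intro t ht
    have hsub : Icc t 1 ⊆ Icc 0 1 := Icc_subset_Icc_left ht.1.le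
    have hT : IsClosed (planeToRP2 ⁻¹' (G '' Icc (θ 1) s)) :=
      (isCompact_Icc.image hG).isClosed.preimage hι.continuous
    have hTr : planeToRP2 '' (planeToRP2 ⁻¹' (G '' Icc (θ 1) s)) = G '' Icc (θ 1) s := by
      rw [image_preimage_eq_iff]
      rintro _ ⟨r, hr, rfl⟩
      rcases hr.2.eq_or_lt with h | h
      · exact ⟨E, by rw [hE, h]⟩
      · obtain ⟨z, _, hz⟩ := hbefore r ⟨hr.1, h⟩
        exact ⟨z, hz⟩
    have hTp : IsPathConnected (planeToRP2 ⁻¹' (G '' Icc (θ 1) s)) := by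
      rw [hι.isInducing.isPathConnected_iff, hTr]
      exact ((convex_Icc _ _).isPathConnected ⟨s, hθs.le, le_rfl⟩).image hG
    refine ⟨a '' Icc t 1 ∪ planeToRP2 ⁻¹' (G '' Icc (θ 1) s), ?_, ?_, ?_, ?_, ?_⟩
    · exact (isCompact_Icc.image_of_continuousOn (hac.mono hsub)).isClosed.union hT
    · rintro z (hz | ⟨r, -, hr⟩)
      · exact Or.inl ⟨z, image_mono hsub hz, rfl⟩
      · exact Or.inr ⟨r, hr⟩
    · rw [Set.disjoint_left]
      rintro z (⟨r, hr, rfl⟩ | ⟨r, hr, hrz⟩)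
      · exact haU r (hsub hr)
      · rcases hr.2.eq_or_lt with h | h
        · rw [h, ← hE] at hrz
          rwa [← hι.injective hrz]
        · obtain ⟨y, hy, hyr⟩ := hbefore r ⟨hr.1, h⟩
          rw [← hyr] at hrz
          rw [← hι.injective hrz]
          exact fun h => hy (subset_closure h)
    · rintro (⟨r, hr, hra⟩ | ⟨r, hr, hra⟩)
      · have := hai (hsub hr) ⟨le_rfl, zero_le_one⟩ hra
        linarith [hr.1, ht.1]
      · rw [← hG0] at hra
        have := hG1 ⟨hpos.le.trans hr.1, hr.2.trans_lt hs1⟩ zero' hra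
        linarith [hr.1]
    · refine (((hac.mono hsub).joinedIn_image_Icc ⟨le_rfl, ht.2⟩ ⟨ht.2, le_rfl⟩).mono
        subset_union_left).trans ((hTp.joinedIn _ ?_ _ ?_).mono subset_union_right)
      · exact ⟨θ 1, ⟨le_rfl, hθs.le⟩, hGθ 1 one⟩
      · exact ⟨s, ⟨hθs.le, le_rfl⟩, hE.symm⟩

/-- Follow a pseudoline extending an arc, from the start of the arc through its end, until it
reaches the closure of a given neighbourhood `U` of infinity. -/
theorem IsPseudoline.exists_exit_point {L : Set RP2} (hL : IsPseudoline L) {a : ℝ → Plane}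
    (hac : ContinuousOn a (Icc 0 1)) (hai : InjOn a (Icc 0 1))
    (haL : ∀ t ∈ Icc (0 : ℝ) 1, planeToRP2 (a t) ∈ L) {U : Set Plane} (hUc : IsCompact Uᶜ)
    (haU : ∀ t ∈ Icc (0 : ℝ) 1, a t ∉ U) (h1 : a 1 ∉ closure U) :
    ∃ E ∈ closure U, E ∉ U ∧ E ∉ a '' Icc 0 1 ∧ planeToRP2 E ∈ L ∧
      ∀ t ∈ Ioc (0 : ℝ) 1, ∃ K : Set Plane, IsClosed K ∧ (∀ z ∈ K, planeToRP2 z ∈ L) ∧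
        Disjoint K U ∧ a 0 ∉ K ∧ JoinedIn K (a t) E := by
  have hnr := hL.not_subset_range
  obtain ⟨g, hg, hinj, rfl, -⟩ := hL
  have hι := isOpenEmbedding_planeToRP2
  have : Fact ((0 : ℝ) < 1) := ⟨one_pos⟩
  choose! σ hσ using haL
  have hge : Topology.IsClosedEmbedding g := hg.isClosedEmbedding hinj
  have hσc : ContinuousOn σ (Icc 0 1) := by
    rw [hge.isInducing.continuousOn_iff]
    exact (hι.continuous.comp_continuousOn hac).congr hσ
  have hσi : InjOn σ (Icc 0 1) := by
    intro s hs t ht h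
    apply hai hs ht
    apply hι.injective
    rw [← hσ s hs, ← hσ t ht, h]
  have z0 : (0 : ℝ) ∈ Icc (0 : ℝ) 1 := ⟨le_rfl, zero_le_one⟩
  set ψ := AddCircle.openPartialHomeomorphCoe (1 : ℝ) 0 with hψ
  obtain ⟨θ, hθd⟩ : ∃ θ : ℝ → ℝ, θ = fun t => ψ.symm (σ t - σ 0) := ⟨_, rfl⟩
  have htgt : ∀ t ∈ Ioc (0 : ℝ) 1, σ t - σ 0 ∈ ψ.target := by
    intro t ht
    have : σ t - σ 0 ≠ 0 := fun h =>
      ht.1.ne' (hσi (Ioc_subset_Icc_self ht) z0 (sub_eq_zero.1 h))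
    simpa [hψ] using this
  have hθc : ContinuousOn θ (Ioc 0 1) := by
    rw [hθd]
    exact ψ.continuousOn_symm.comp ((hσc.mono Ioc_subset_Icc_self).sub continuousOn_const) htgt
  have hθm : ∀ t ∈ Ioc (0 : ℝ) 1, θ t ∈ Ioo (0 : ℝ) 1 := by
    intro t ht
    have := ψ.map_target (htgt t ht)
    rw [hθd]
    simpa [hψ] using this
  have hθσ : ∀ t ∈ Ioc (0 : ℝ) 1, σ 0 + (θ t : AddCircle (1 : ℝ)) = σ t := by
    intro t ht
    have h := ψ.right_inv (htgt t ht)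
    have : ((θ t : ℝ) : AddCircle (1 : ℝ)) = σ t - σ 0 := by
      rw [hθd]; exact h
    rw [this]; abel
  have hθi : InjOn θ (Ioc 0 1) := by
    intro s hs t ht h
    apply hσi (Ioc_subset_Icc_self hs) (Ioc_subset_Icc_self ht)
    rw [← hθσ s hs, ← hθσ t ht, h]
  have hsurj : ∀ x, ∃ t ∈ Ico (0 : ℝ) 1, σ 0 + (t : AddCircle (1 : ℝ)) = x := by
    intro x
    obtain ⟨t, ht, htx⟩ := (AddCircle.coe_image_Ico_eq (1 : ℝ) 0 ▸ mem_univ (x - σ 0) :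
      x - σ 0 ∈ _ '' Ico (0:ℝ) (0 + 1))
    exact ⟨t, by simpa using ht, by rw [htx]; abel⟩
  have hside : (∀ t ∈ Ioo (0 : ℝ) 1, θ t < θ 1) ∨ ∀ t ∈ Ioo (0 : ℝ) 1, θ 1 < θ t := by
    by_contra! h
    obtain ⟨⟨s, hs, hs'⟩, ⟨t, ht, ht'⟩⟩ := h
    obtain ⟨r, hr, hr'⟩ := isPreconnected_Ioo.intermediate_value ht hs
      (hθc.mono Ioo_subset_Ioc_self) ⟨ht', hs'⟩
    exact hr.2.ne (hθi (Ioo_subset_Ioc_self hr) ⟨one_pos, le_rfl⟩ hr')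
  have hLa : ∀ z, planeToRP2 z ∈ planeToRP2 '' (a '' Icc 0 1) → planeToRP2 z ∈ range g := by
    rintro z ⟨_, ⟨t, ht, rfl⟩, h⟩
    rw [← h]
    exact ⟨σ t, hσ t ht⟩
  have main : ∀ (G : ℝ → RP2) (θ' : ℝ → ℝ), Continuous G → InjOn G (Ico 0 1) →
      G 0 = planeToRP2 (a 0) → G 1 = G 0 → (∀ x, ∃ t ∈ Icc (0 : ℝ) 1, G t = g x) →
      range G ⊆ range g → ContinuousOn θ' (Ioc 0 1) →
      (∀ t ∈ Ioc (0 : ℝ) 1, θ' t ∈ Ioo (0 : ℝ) 1) →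
      (∀ t ∈ Ioc (0 : ℝ) 1, G (θ' t) = planeToRP2 (a t)) →
      (∀ t ∈ Ioo (0 : ℝ) 1, θ' t < θ' 1) →
      ∃ E ∈ closure U, E ∉ U ∧ E ∉ a '' Icc 0 1 ∧ planeToRP2 E ∈ range g ∧
        ∀ t ∈ Ioc (0 : ℝ) 1, ∃ K : Set Plane, IsClosed K ∧ (∀ z ∈ K, planeToRP2 z ∈ range g) ∧
          Disjoint K U ∧ a 0 ∉ K ∧ JoinedIn K (a t) E := by
    intro G θ' hG hG1 hG0 hG01 hGs hGr h₁ h₂ h₃ h₄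
    obtain ⟨E, hE1, hE2, hE3, hE4, hE5⟩ := exists_exit_point_of_param hac hai hG hG1 hG0 hG01
      (fun h => hnr (by
        rintro _ ⟨x, rfl⟩
        obtain ⟨t, ht, hx⟩ := hGs x
        exact hx ▸ h t ht)) h₁ h₂ h₃ h₄ hUc haU h1
    refine ⟨E, hE1, hE2, hE3, hGr hE4, fun t ht => ?_⟩
    obtain ⟨K, hK1, hK2, hK3⟩ := hE5 t ht
    exact ⟨K, hK1, fun z hz => (hK2 z hz).elim (hLa z) fun h => hGr h, hK3⟩
  rcases hside with hside | hside
  · refine main (fun t => g (σ 0 + t)) θ (hg.comp (continuous_const.add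
      (AddCircle.continuous_mk' 1))) (hinj.injOn.comp (AddCircle.injOn_const_add_coe
      (fun s hs t ht => by rw [abs_lt]; constructor <;> linarith [hs.1, hs.2, ht.1, ht.2]) _)
      (mapsTo_univ _ _)) ?_ ?_ ?_ ?_ hθc hθm ?_ hside
    · simp [hσ 0 z0]
    · simp [AddCircle.coe_period]
    · intro x
      obtain ⟨t, ht, h⟩ := hsurj x
      exact ⟨t, Ico_subset_Icc_self ht, by rw [h]⟩
    · rintro _ ⟨t, rfl⟩
      exact mem_range_self _
    · intro t ht
      simp only [hθσ t ht, hσ t (Ioc_subset_Icc_self ht)]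
  · refine main (fun t => g (σ 0 + ((1 - t : ℝ) : AddCircle (1 : ℝ)))) (fun t => 1 - θ t)
      (hg.comp (continuous_const.add ((AddCircle.continuous_mk' 1).comp
      (continuous_const.sub continuous_id)))) ?_ ?_ ?_ ?_ ?_ (continuousOn_const.sub hθc) ?_ ?_ ?_
    · intro s hs t ht h
      have := AddCircle.injOn_const_add_coe (S := Ioc 0 1)
        (fun s hs t ht => by rw [abs_lt]; constructor <;> linarith [hs.1, hs.2, ht.1, ht.2]) _
        (show 1 - s ∈ Ioc (0 : ℝ) 1 by constructor <;> linarith [hs.1, hs.2])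
        (show 1 - t ∈ Ioc (0 : ℝ) 1 by constructor <;> linarith [ht.1, ht.2]) (hinj h)
      linarith
    · simp [AddCircle.coe_period, hσ 0 z0]
    · simp [AddCircle.coe_period]
    · intro x
      obtain ⟨t, ht, h⟩ := hsurj x
      exact ⟨1 - t, ⟨by linarith [ht.2], by linarith [ht.1]⟩, by simp only [sub_sub_cancel, h]⟩
    · rintro _ ⟨t, rfl⟩
      exact mem_range_self _
    · intro t ht
      have := hθm t ht
      exact ⟨by linarith [this.2], by linarith [this.1]⟩
    · intro t ht
      simp only [sub_sub_cancel, hθσ t ht, hσ t (Ioc_subset_Icc_self ht)]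
    · intro t ht
      linarith [hside t ht]

theorem not_planar_three_three_prod (x y : Fin 3 → ℝ × ℝ) (E : Fin 3 → Fin 3 → Set (ℝ × ℝ))
    (hE : ∀ i j, JoinedIn (E i j) (x i) (y j))
    (hd : ∀ i j k l, i ≠ k → j ≠ l → Disjoint (E i j) (E k l)) : False := by
  let e := Complex.equivRealProdCLM.symm
  refine not_planar_three_three (fun i => e (x i)) (fun j => e (y j)) (fun i j => e '' E i j)
    (fun i j => ?_) fun i j k l h h' => ?_
  · obtain ⟨γ, hγ⟩ := hE i j
    exact ⟨γ.map e.continuous, fun t => ⟨γ t, hγ t, rfl⟩⟩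
  · exact (disjoint_image_iff e.injective).2 (hd i j k l h h')

theorem joinedIn_compl_of_mem_closure {E : Type*} [TopologicalSpace E] [LocallyPathConnectedSpace E]
    {U Z : Set E} (hU : IsPreconnected U) (hZ : IsClosed Z) (hZU : Disjoint Z U) {p q : E}
    (hp : p ∈ closure U) (hq : q ∈ closure U) (hpZ : p ∉ Z) (hqZ : q ∉ Z) : JoinedIn Zᶜ p q := by
  have hpre : IsPreconnected (Zᶜ ∩ closure U) :=
    hU.subset_closure (fun z hz => ⟨fun h => Set.disjoint_left.1 hZU h hz, subset_closure hz⟩)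
      inter_subset_right
  have hsub := hpre.subset_connectedComponentIn ⟨hpZ, hp⟩ inter_subset_left
  have hC : IsConnected (connectedComponentIn Zᶜ p) := isConnected_connectedComponentIn_iff.2 hpZ
  have := hZ.isOpen_compl.connectedComponentIn (x := p)
  exact ((this.isConnected_iff_isPathConnected.1 hC).joinedIn _ (hsub ⟨hpZ, hp⟩) _
    (hsub ⟨hqZ, hq⟩)).mono (connectedComponentIn_subset _ _)

theorem Set.Subsingleton.disjoint_of_subset {α : Type*} {L M S T : Set α}
    (h : (L ∩ M).Subsingleton) (hS : S ⊆ L) (hT : T ⊆ M) {w : α} (hwL : w ∈ L) (hwM : w ∈ M)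
    (hw : w ∉ S ∨ w ∉ T) : Disjoint S T := by
  rw [Set.disjoint_left]
  intro z hzS hzT
  have : z = w := h ⟨hS hzS, hT hzT⟩ ⟨hwL, hwM⟩
  subst this
  exact hw.elim (fun h => h hzS) fun h => h hzT

/-- `ExitsAt a L U E`: the arc `a` can be continued in `L`, avoiding `U` and the starting point of
`a`, up to a point `E` that does not lie on `a`. -/
def ExitsAt (a : ℝ → Plane) (L U : Set Plane) (E : Plane) : Prop :=
  E ∈ L ∧ E ∉ a '' Icc 0 1 ∧ ∀ t ∈ Ioc (0 : ℝ) 1, ∃ K ⊆ L, IsClosed K ∧ Disjoint K U ∧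
    a 0 ∉ K ∧ JoinedIn K (a t) E

theorem ExitsAt.exists_of_mem {a : ℝ → Plane} {L U : Set Plane} {E z : Plane}
    (h : ExitsAt a L U E) (hz : z ∈ a '' Icc 0 1) (hz0 : z ≠ a 0) :
    ∃ K ⊆ L, IsClosed K ∧ Disjoint K U ∧ a 0 ∉ K ∧ JoinedIn K z E := by
  obtain ⟨t, ht, rfl⟩ := hz
  exact h.2.2 t ⟨lt_of_le_of_ne ht.1 fun h => hz0 (by rw [h]), ht.2⟩

theorem false_of_exitsAt_of_mem {a₁ a₂ b₁ b₂ : ℝ → Plane} (ha₁ : ContinuousOn a₁ (Icc 0 1))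
    (ha₂ : ContinuousOn a₂ (Icc 0 1)) (hb₁ : ContinuousOn b₁ (Icc 0 1))
    (hb₂ : ContinuousOn b₂ (Icc 0 1)) {L₁ L₂ M₁ M₂ U : Set Plane} (hU : IsPreconnected U)
    {p q : Plane} (hp : p ∈ closure U) (hq : q ∈ closure U) (ha₁p : a₁ 0 = p) (ha₂p : a₂ 0 = p)
    (hb₁q : b₁ 0 = q) (hb₂q : b₂ 0 = q) (haL₁ : a₁ '' Icc 0 1 ⊆ L₁) (haL₂ : a₂ '' Icc 0 1 ⊆ L₂)
    (hbM₁ : b₁ '' Icc 0 1 ⊆ M₁) (hbM₂ : b₂ '' Icc 0 1 ⊆ M₂) (hL : (L₁ ∩ L₂).Subsingleton)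
    (hM : (M₁ ∩ M₂).Subsingleton) (h₁₁ : (L₁ ∩ M₁).Subsingleton) (h₁₂ : (L₁ ∩ M₂).Subsingleton)
    (h₂₁ : (L₂ ∩ M₁).Subsingleton) (h₂₂ : (L₂ ∩ M₂).Subsingleton) {E₁ E₂ F₁ F₂ : Plane}
    (hE₁ : ExitsAt a₁ L₁ U E₁) (hE₂ : ExitsAt a₂ L₂ U E₂) (hF₁ : ExitsAt b₁ M₁ U F₁)
    (hF₂ : ExitsAt b₂ M₂ U F₂) (hEb₁ : E₁ ∈ b₂ '' Icc 0 1) (hEb₂ : E₂ ∈ b₁ '' Icc 0 1)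
    (hFa₁ : F₁ ∈ a₁ '' Icc 0 1) (hFa₂ : F₂ ∈ a₂ '' Icc 0 1) : False := by
  have z0 : (0 : ℝ) ∈ Icc (0 : ℝ) 1 := ⟨le_rfl, zero_le_one⟩
  have pa₁ : p ∈ a₁ '' Icc 0 1 := ⟨0, z0, ha₁p⟩
  have pa₂ : p ∈ a₂ '' Icc 0 1 := ⟨0, z0, ha₂p⟩
  have qb₁ : q ∈ b₁ '' Icc 0 1 := ⟨0, z0, hb₁q⟩
  have qb₂ : q ∈ b₂ '' Icc 0 1 := ⟨0, z0, hb₂q⟩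
  have pM₁ : p ∉ M₁ := fun h => hE₂.2.1 (h₂₁ ⟨haL₂ pa₂, h⟩ ⟨hE₂.1, hbM₁ hEb₂⟩ ▸ pa₂)
  have pM₂ : p ∉ M₂ := fun h => hE₁.2.1 (h₁₂ ⟨haL₁ pa₁, h⟩ ⟨hE₁.1, hbM₂ hEb₁⟩ ▸ pa₁)
  have qL₁ : q ∉ L₁ := fun h => hF₁.2.1 (h₁₁ ⟨h, hbM₁ qb₁⟩ ⟨haL₁ hFa₁, hF₁.1⟩ ▸ qb₁)
  have qL₂ : q ∉ L₂ := fun h => hF₂.2.1 (h₂₂ ⟨h, hbM₂ qb₂⟩ ⟨haL₂ hFa₂, hF₂.1⟩ ▸ qb₂)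
  obtain ⟨A, hAL, hAc, hAU, hAp, hAj⟩ := hE₁.exists_of_mem hFa₁
    (fun h => pM₁ (ha₁p ▸ h ▸ hF₁.1))
  obtain ⟨B, hBL, hBc, hBU, hBp, hBj⟩ := hE₂.exists_of_mem hFa₂
    (fun h => pM₂ (ha₂p ▸ h ▸ hF₂.1))
  obtain ⟨C, hCM, hCc, hCU, hCq, hCj⟩ := hF₁.exists_of_mem hEb₂
    (fun h => qL₂ (hb₁q ▸ h ▸ hE₂.1))
  obtain ⟨D, hDM, hDc, hDU, hDq, hDj⟩ := hF₂.exists_of_mem hEb₁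
    (fun h => qL₁ (hb₂q ▸ h ▸ hE₁.1))
  rw [ha₁p] at hAp
  rw [ha₂p] at hBp
  rw [hb₁q] at hCq
  rw [hb₂q] at hDq
  have hW : JoinedIn (A ∪ B ∪ C ∪ D)ᶜ q p := by
    refine joinedIn_compl_of_mem_closure hU (((hAc.union hBc).union hCc).union hDc) ?_ hq hp ?_ ?_
    · simp only [disjoint_union_left]
      exact ⟨⟨⟨hAU, hBU⟩, hCU⟩, hDU⟩
    · rintro (((h | h) | h) | h)
      exacts [qL₁ (hAL h), qL₂ (hBL h), hCq h, hDq h]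
    · rintro (((h | h) | h) | h)
      exacts [hAp h, hBp h, pM₁ (hCM h), pM₂ (hDM h)]
  have join : ∀ {a : ℝ → Plane}, ContinuousOn a (Icc 0 1) → ∀ {x y}, x ∈ a '' Icc 0 1 →
      y ∈ a '' Icc 0 1 → JoinedIn (a '' Icc 0 1) x y := by
    rintro a ha _ _ ⟨s, hs, rfl⟩ ⟨t, ht, rfl⟩
    exact ha.joinedIn_image_Icc hs ht
  have dAB := hL.disjoint_of_subset hAL hBL (haL₁ pa₁) (haL₂ pa₂) (.inl hAp)
  have dAa := hL.disjoint_of_subset hAL haL₂ (haL₁ pa₁) (haL₂ pa₂) (.inl hAp)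
  have daB := hL.disjoint_of_subset haL₁ hBL (haL₁ pa₁) (haL₂ pa₂) (.inr hBp)
  have dCD := hM.disjoint_of_subset hCM hDM (hbM₁ qb₁) (hbM₂ qb₂) (.inl hCq)
  have dCb := hM.disjoint_of_subset hCM hbM₂ (hbM₁ qb₁) (hbM₂ qb₂) (.inl hCq)
  have dbD := hM.disjoint_of_subset hbM₁ hDM (hbM₁ qb₁) (hbM₂ qb₂) (.inr hDq)
  have daC := h₂₁.disjoint_of_subset haL₂ hCM hE₂.1 (hbM₁ hEb₂) (.inl hE₂.2.1)
  have daD := h₁₂.disjoint_of_subset haL₁ hDM hE₁.1 (hbM₂ hEb₁) (.inl hE₁.2.1)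
  have dAb := h₁₁.disjoint_of_subset hAL hbM₁ (haL₁ hFa₁) hF₁.1 (.inr hF₁.2.1)
  have dBb := h₂₂.disjoint_of_subset hBL hbM₂ (haL₂ hFa₂) hF₂.1 (.inr hF₂.2.1)
  have d₁₁ := h₁₁.disjoint_of_subset haL₁ hbM₁ (haL₁ hFa₁) hF₁.1 (.inr hF₁.2.1)
  have d₂₂ := h₂₂.disjoint_of_subset haL₂ hbM₂ (haL₂ hFa₂) hF₂.1 (.inr hF₂.2.1)
  have d₁₂ := h₁₂.disjoint_of_subset haL₁ hbM₂ hE₁.1 (hbM₂ hEb₁) (.inl hE₁.2.1)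
  have d₂₁ := h₂₁.disjoint_of_subset haL₂ hbM₁ hE₂.1 (hbM₁ hEb₂) (.inl hE₂.2.1)
  have dW : ∀ {Z}, Z ⊆ A ∪ B ∪ C ∪ D → Disjoint (A ∪ B ∪ C ∪ D)ᶜ Z := fun h =>
    disjoint_compl_left.mono_right h
  have dWA := dW (subset_union_left.trans (subset_union_left.trans subset_union_left))
  have dWB := dW (subset_union_right.trans (subset_union_left.trans subset_union_left))
  have dWC := dW (subset_union_right.trans subset_union_left)
  have dWD := dW subset_union_right
  refine not_planar_three_three_prod ![F₁, F₂, q] ![E₁, E₂, p]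
    ![![A, C, a₁ '' Icc 0 1], ![D, B, a₂ '' Icc 0 1],
      ![b₂ '' Icc 0 1, b₁ '' Icc 0 1, (A ∪ B ∪ C ∪ D)ᶜ]] ?_ ?_
  · have := join ha₁ hFa₁ pa₁
    have := join ha₂ hFa₂ pa₂
    have := join hb₁ qb₁ hEb₂
    have := join hb₂ qb₂ hEb₁
    have := hCj.symm
    have := hDj.symm
    intro i j
    fin_cases i <;> fin_cases j <;> assumption
  · intro i j k l hik hjl
    fin_cases i <;> fin_cases k <;> first | exact absurd rfl hik | skip
    all_goals fin_cases j <;> fin_cases l <;> first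
      | exact absurd rfl hjl
      | assumption
      | (apply Disjoint.symm; assumption)

theorem false_of_exitsAt {a₁ a₂ b₁ b₂ : ℝ → Plane} (ha₁ : ContinuousOn a₁ (Icc 0 1))
    (ha₂ : ContinuousOn a₂ (Icc 0 1)) (hb₁ : ContinuousOn b₁ (Icc 0 1))
    (hb₂ : ContinuousOn b₂ (Icc 0 1)) {L₁ L₂ M₁ M₂ U : Set Plane} (hU : IsPreconnected U)
    {p q : Plane} (hp : p ∈ closure U) (hq : q ∈ closure U) (ha₁p : a₁ 0 = p) (ha₂p : a₂ 0 = p)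
    (hb₁q : b₁ 0 = q) (hb₂q : b₂ 0 = q) (haL₁ : a₁ '' Icc 0 1 ⊆ L₁) (haL₂ : a₂ '' Icc 0 1 ⊆ L₂)
    (hbM₁ : b₁ '' Icc 0 1 ⊆ M₁) (hbM₂ : b₂ '' Icc 0 1 ⊆ M₂) (hL : (L₁ ∩ L₂).Subsingleton)
    (hM : (M₁ ∩ M₂).Subsingleton) (h₁₁ : (L₁ ∩ M₁).Subsingleton) (h₁₂ : (L₁ ∩ M₂).Subsingleton)
    (h₂₁ : (L₂ ∩ M₁).Subsingleton) (h₂₂ : (L₂ ∩ M₂).Subsingleton) {E₁ E₂ F₁ F₂ : Plane}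
    (hE₁ : ExitsAt a₁ L₁ U E₁) (hE₂ : ExitsAt a₂ L₂ U E₂) (hF₁ : ExitsAt b₁ M₁ U F₁)
    (hF₂ : ExitsAt b₂ M₂ U F₂)
    (hE : ∀ z ∈ ({E₁, E₂, F₁, F₂} : Set Plane), z ∈ a₁ '' Icc 0 1 ∪ a₂ '' Icc 0 1 ∪
      b₁ '' Icc 0 1 ∪ b₂ '' Icc 0 1) : False := by
  have z0 : (0 : ℝ) ∈ Icc (0 : ℝ) 1 := ⟨le_rfl, zero_le_one⟩
  have pa₁ : p ∈ a₁ '' Icc 0 1 := ⟨0, z0, ha₁p⟩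
  have pa₂ : p ∈ a₂ '' Icc 0 1 := ⟨0, z0, ha₂p⟩
  have qb₁ : q ∈ b₁ '' Icc 0 1 := ⟨0, z0, hb₁q⟩
  have qb₂ : q ∈ b₂ '' Icc 0 1 := ⟨0, z0, hb₂q⟩
  have e₁ : E₁ ∈ b₁ '' Icc 0 1 ∨ E₁ ∈ b₂ '' Icc 0 1 := by
    rcases hE E₁ (by simp) with ((h | h) | h) | h
    · exact absurd h hE₁.2.1
    · exact absurd (hL ⟨haL₁ pa₁, haL₂ pa₂⟩ ⟨hE₁.1, haL₂ h⟩ ▸ pa₁) hE₁.2.1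
    · exact .inl h
    · exact .inr h
  have e₂ : E₂ ∈ b₁ '' Icc 0 1 ∨ E₂ ∈ b₂ '' Icc 0 1 := by
    rcases hE E₂ (by simp) with ((h | h) | h) | h
    · exact absurd (hL ⟨haL₁ pa₁, haL₂ pa₂⟩ ⟨haL₁ h, hE₂.1⟩ ▸ pa₂) hE₂.2.1
    · exact absurd h hE₂.2.1
    · exact .inl h
    · exact .inr h
  have f₁ : F₁ ∈ a₁ '' Icc 0 1 ∨ F₁ ∈ a₂ '' Icc 0 1 := by
    rcases hE F₁ (by simp) with ((h | h) | h) | h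
    · exact .inl h
    · exact .inr h
    · exact absurd h hF₁.2.1
    · exact absurd (hM ⟨hbM₁ qb₁, hbM₂ qb₂⟩ ⟨hF₁.1, hbM₂ h⟩ ▸ qb₁) hF₁.2.1
  have f₂ : F₂ ∈ a₁ '' Icc 0 1 ∨ F₂ ∈ a₂ '' Icc 0 1 := by
    rcases hE F₂ (by simp) with ((h | h) | h) | h
    · exact .inl h
    · exact .inr h
    · exact absurd (hM ⟨hbM₁ qb₁, hbM₂ qb₂⟩ ⟨hbM₁ h, hF₂.1⟩ ▸ qb₂) hF₂.2.1
    · exact absurd h hF₂.2.1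
  have k₁₁ : E₁ ∈ b₁ '' Icc 0 1 → F₁ ∉ a₁ '' Icc 0 1 := fun h h' =>
    hF₁.2.1 (h₁₁ ⟨hE₁.1, hbM₁ h⟩ ⟨haL₁ h', hF₁.1⟩ ▸ h)
  have k₁₂ : E₁ ∈ b₂ '' Icc 0 1 → F₂ ∉ a₁ '' Icc 0 1 := fun h h' =>
    hF₂.2.1 (h₁₂ ⟨hE₁.1, hbM₂ h⟩ ⟨haL₁ h', hF₂.1⟩ ▸ h)
  have k₂₁ : E₂ ∈ b₁ '' Icc 0 1 → F₁ ∉ a₂ '' Icc 0 1 := fun h h' =>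
    hF₁.2.1 (h₂₁ ⟨hE₂.1, hbM₁ h⟩ ⟨haL₂ h', hF₁.1⟩ ▸ h)
  have k₂₂ : E₂ ∈ b₂ '' Icc 0 1 → F₂ ∉ a₂ '' Icc 0 1 := fun h h' =>
    hF₂.2.1 (h₂₂ ⟨hE₂.1, hbM₂ h⟩ ⟨haL₂ h', hF₂.1⟩ ▸ h)
  rcases e₁ with e₁ | e₁ <;> rcases e₂ with e₂ | e₂
  · exact f₁.elim (k₁₁ e₁) (k₂₁ e₂)
  · exact false_of_exitsAt_of_mem ha₁ ha₂ hb₂ hb₁ hU hp hq ha₁p ha₂p hb₂q hb₁q haL₁ haL₂ hbM₂ hbM₁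
      hL (inter_comm M₁ M₂ ▸ hM) h₁₂ h₁₁ h₂₂ h₂₁ hE₁ hE₂ hF₂ hF₁ e₁ e₂
      (f₂.resolve_right (k₂₂ e₂)) (f₁.resolve_left (k₁₁ e₁))
  · exact false_of_exitsAt_of_mem ha₁ ha₂ hb₁ hb₂ hU hp hq ha₁p ha₂p hb₁q hb₂q haL₁ haL₂ hbM₁ hbM₂
      hL hM h₁₁ h₁₂ h₂₁ h₂₂ hE₁ hE₂ hF₁ hF₂ e₁ e₂
      (f₁.resolve_right (k₂₁ e₂)) (f₂.resolve_left (k₁₂ e₁))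
  · exact f₂.elim (k₁₂ e₁) (k₂₂ e₂)

/-- The arc of an edge, parametrized from a prescribed end. -/
theorem Drawing.exists_param {V : Type*} {G : SimpleGraph V} (D : Drawing G) {x y : V}
    (e : G.edgeSet) (he : (e : Sym2 V) = s(x, y)) :
    ∃ a : ℝ → Plane, ContinuousOn a (Icc 0 1) ∧ InjOn a (Icc 0 1) ∧ a 0 = D.vert x ∧
      a 1 = D.vert y ∧ a '' Icc 0 1 = D.arc e '' Icc 0 1 := by
  obtain ⟨u, v, huv, h0, h1⟩ := D.arc_ends e
  rw [he, Sym2.eq_iff] at huv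
  rcases huv with ⟨rfl, rfl⟩ | ⟨rfl, rfl⟩
  · exact ⟨D.arc e, D.arc_cont e, D.arc_injOn e, h0, h1, rfl⟩
  · have hm : MapsTo (fun t : ℝ => 1 - t) (Icc 0 1) (Icc 0 1) := fun t ht =>
      ⟨by linarith [ht.2], by linarith [ht.1]⟩
    refine ⟨fun t => D.arc e (1 - t), (D.arc_cont e).comp (by fun_prop) hm,
      (D.arc_injOn e).comp (fun s _ t _ h => by simpa using h) hm, by simpa, by simpa, ?_⟩
    rw [show (fun t => D.arc e (1 - t)) = D.arc e ∘ fun t => 1 - t from rfl, image_comp,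
      image_const_sub_Icc]
    simp

theorem exists_unbounded_connectedComponentIn_compl {E : Type*} [NormedAddCommGroup E]
    [NormedSpace ℝ E] [ProperSpace E] (hE : 1 < Module.rank ℝ E) {S : Set E} (hS : IsCompact S) :
    ∃ x ∉ S, ¬ Bornology.IsBounded (connectedComponentIn Sᶜ x) ∧
      IsCompact (connectedComponentIn Sᶜ x)ᶜ := by
  obtain ⟨r, hr⟩ := hS.isBounded.exists_norm_le
  have hR : 0 < max r 0 + 1 := by positivity
  have hsub : {z : E | max r 0 + 1 ≤ ‖z‖} ⊆ Sᶜ := fun z hz h => by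
    have := hr z h
    have h' : max r 0 + 1 ≤ ‖z‖ := hz
    linarith [le_max_left r 0]
  have hpc := isPathConnected_compl_ball hE hR
  obtain ⟨x, hx⟩ := hpc.nonempty
  have hU := hpc.isConnected.isPreconnected.subset_connectedComponentIn hx hsub
  have hc : Bornology.IsBounded (connectedComponentIn Sᶜ x)ᶜ :=
    (Metric.isBounded_closedBall (x := (0 : E)) (r := max r 0 + 1)).subset fun z hz => by
      by_contra h
      rw [mem_closedBall_zero_iff, not_le] at h
      exact hz (hU h.le)
  have ho := hS.isClosed.isOpen_compl.connectedComponentIn (x := x)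
  refine ⟨x, hsub hx, fun h => ?_, Metric.isCompact_of_isClosed_isBounded ho.isClosed_compl hc⟩
  have : Nontrivial E := (rank_pos_iff_nontrivial (R := ℝ)).1 (zero_lt_one.trans hE)
  refine NormedSpace.unbounded_univ ℝ E ?_
  rw [← union_compl_self (connectedComponentIn Sᶜ x)]
  exact h.union hc

theorem mem_connectedComponentIn_compl_of_mem_closure {E : Type*} [TopologicalSpace E]
    [LocallyConnectedSpace E] {S : Set E} (hS : IsClosed S) {x y : E}
    (hy : y ∈ closure (connectedComponentIn Sᶜ x)) (hyS : y ∉ S) :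
    y ∈ connectedComponentIn Sᶜ x := by
  obtain ⟨z, hz, hz'⟩ := mem_closure_iff.1 hy _ (hS.isOpen_compl.connectedComponentIn (x := y))
    (mem_connectedComponentIn hyS)
  rw [connectedComponentIn_eq hz', ← connectedComponentIn_eq hz]
  exact mem_connectedComponentIn hyS

/-- Theorem (an obstacle to pseudolinearity).  Let `P = p₀ p₁ p₂` and
`Q = q₀ q₁ q₂` be vertex-disjoint 2-paths of a graph `G`, and let `D` be a drawing
of `G`.  Suppose that the restriction of `D` to `P ∪ Q` is a clam, i.e. letting
`S` be the union of the four arcs of `D` drawing the edges of `P ∪ Q`: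
the complement of `S` has exactly two connected components (regions), and any
unbounded region is incident (in its closure) with the internal vertices `p₁`,
`q₁` and with none of the other four vertices.  Then `D` is not pseudolinear. -/
theorem clam_not_pseudolinear {V : Type*} [Fintype V] {G : SimpleGraph V}
    (p₀ p₁ p₂ q₀ q₁ q₂ : V)
    (hnodup : List.Nodup [p₀, p₁, p₂, q₀, q₁, q₂])
    (hP₀ : G.Adj p₀ p₁) (hP₁ : G.Adj p₁ p₂)
    (hQ₀ : G.Adj q₀ q₁) (hQ₁ : G.Adj q₁ q₂)
    (D : Drawing G) (S : Set Plane)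
    (hS : S = D.arc ⟨s(p₀, p₁), G.mem_edgeSet.mpr hP₀⟩ '' Icc 0 1 ∪
              D.arc ⟨s(p₁, p₂), G.mem_edgeSet.mpr hP₁⟩ '' Icc 0 1 ∪
              D.arc ⟨s(q₀, q₁), G.mem_edgeSet.mpr hQ₀⟩ '' Icc 0 1 ∪
              D.arc ⟨s(q₁, q₂), G.mem_edgeSet.mpr hQ₁⟩ '' Icc 0 1)
    (htwo : {C : Set Plane | ∃ x ∉ S, C = connectedComponentIn Sᶜ x}.ncard = 2)
    (hout : ∀ C : Set Plane, (∃ x ∉ S, C = connectedComponentIn Sᶜ x) →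
      ¬ Bornology.IsBounded C →
        D.vert p₁ ∈ closure C ∧ D.vert q₁ ∈ closure C ∧
        D.vert p₀ ∉ closure C ∧ D.vert p₂ ∉ closure C ∧
        D.vert q₀ ∉ closure C ∧ D.vert q₂ ∉ closure C) :
    ¬ D.IsPseudolinear := by
  rintro ⟨L, hL, harc, hcross⟩
  have hι := isOpenEmbedding_planeToRP2.injective
  have hsub : ∀ e f, e ≠ f → (planeToRP2 ⁻¹' L e ∩ planeToRP2 ⁻¹' L f).Subsingleton :=
    fun e f h y hy z hz => hι ((hcross e f h).unique hy hz)
  set e₁ : G.edgeSet := ⟨s(p₀, p₁), G.mem_edgeSet.mpr hP₀⟩ with he₁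
  set e₂ : G.edgeSet := ⟨s(p₁, p₂), G.mem_edgeSet.mpr hP₁⟩ with he₂
  set f₁ : G.edgeSet := ⟨s(q₀, q₁), G.mem_edgeSet.mpr hQ₀⟩ with hf₁
  set f₂ : G.edgeSet := ⟨s(q₁, q₂), G.mem_edgeSet.mpr hQ₁⟩ with hf₂
  have hcompact : ∀ e, IsCompact (D.arc e '' Icc 0 1) := fun e =>
    isCompact_Icc.image_of_continuousOn (D.arc_cont e)
  have hSc : IsCompact S := hS ▸
    (((hcompact e₁).union (hcompact e₂)).union (hcompact f₁)).union (hcompact f₂)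
  have hrank : 1 < Module.rank ℝ Plane := by
    simp [one_add_one_eq_two]
  obtain ⟨x, hx, hxb, hxc⟩ := exists_unbounded_connectedComponentIn_compl hrank hSc
  obtain ⟨hp, hq, hp₀, hp₂, hq₀, hq₂⟩ := hout _ ⟨x, hx, rfl⟩ hxb
  have key : ∀ (e : G.edgeSet) (u v : V), (e : Sym2 V) = s(u, v) → D.arc e '' Icc 0 1 ⊆ S →
      D.vert v ∉ closure (connectedComponentIn Sᶜ x) →
      ∃ a : ℝ → Plane, ∃ E ∈ S, ContinuousOn a (Icc 0 1) ∧ a 0 = D.vert u ∧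
        a '' Icc 0 1 = D.arc e '' Icc 0 1 ∧ a '' Icc 0 1 ⊆ planeToRP2 ⁻¹' L e ∧
        ExitsAt a (planeToRP2 ⁻¹' L e) (connectedComponentIn Sᶜ x) E := by
    intro e u v he heS hv
    obtain ⟨a, hac, hai, ha0, ha1, hae⟩ := D.exists_param e he
    have haL : ∀ t ∈ Icc (0 : ℝ) 1, planeToRP2 (a t) ∈ L e := by
      intro t ht
      obtain ⟨r, hr, h⟩ := hae ▸ mem_image_of_mem a ht
      exact h ▸ harc e r hr
    obtain ⟨E, hEcl, hEU, hEa, hEL, hK⟩ := (hL e).exists_exit_point hac hai haL hxc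
      (fun t ht h => connectedComponentIn_subset _ _ h (heS (hae ▸ mem_image_of_mem a ht)))
      (ha1 ▸ hv)
    refine ⟨a, E, ?_, hac, ha0, hae, image_subset_iff.2 haL, hEL, hEa, fun t ht => ?_⟩
    · by_contra h
      exact hEU (mem_connectedComponentIn_compl_of_mem_closure hSc.isClosed hEcl h)
    · obtain ⟨K, h1, h2, h3⟩ := hK t ht
      exact ⟨K, h2, h1, h3⟩
  obtain ⟨a₁, E₁, hE₁, ha₁, ha₁p, hae₁, haL₁, hE₁'⟩ := key e₁ p₁ p₀ Sym2.eq_swap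
    (by rw [hS]; exact fun z h => .inl (.inl (.inl h))) hp₀
  obtain ⟨a₂, E₂, hE₂, ha₂, ha₂p, hae₂, haL₂, hE₂'⟩ := key e₂ p₁ p₂ rfl
    (by rw [hS]; exact fun z h => .inl (.inl (.inr h))) hp₂
  obtain ⟨b₁, F₁, hF₁, hb₁, hb₁q, hbf₁, hbM₁, hF₁'⟩ := key f₁ q₁ q₀ Sym2.eq_swap
    (by rw [hS]; exact fun z h => .inl (.inr h)) hq₀
  obtain ⟨b₂, F₂, hF₂, hb₂, hb₂q, hbf₂, hbM₂, hF₂'⟩ := key f₂ q₁ q₂ rfl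
    (by rw [hS]; exact fun z h => .inr h) hq₂
  simp only [List.nodup_cons, List.mem_cons, not_or] at hnodup
  refine false_of_exitsAt ha₁ ha₂ hb₁ hb₂ isPreconnected_connectedComponentIn hp hq ha₁p ha₂p
    hb₁q hb₂q haL₁ haL₂ hbM₁ hbM₂ (hsub e₁ e₂ ?_) (hsub f₁ f₂ ?_) (hsub e₁ f₁ ?_) (hsub e₁ f₂ ?_)
    (hsub e₂ f₁ ?_) (hsub e₂ f₂ ?_) hE₁' hE₂' hF₁' hF₂' ?_
  iterate 6
    intro h
    simp only [he₁, he₂, hf₁, hf₂, Subtype.mk.injEq, Sym2.eq_iff] at h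
    grind
  rw [hae₁, hae₂, hbf₁, hbf₂, ← hS]
  simp only [mem_insert_iff, mem_singleton_iff, forall_eq_or_imp, forall_eq]
  exact ⟨hE₁, hE₂, hF₁, hF₂⟩

end
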